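/- arXiv:1609.02670 — 4 statements merged into one kernel-verified Lean document; each statement's English description precedes it below -/
import Mathlib

section
/- (Corollary 2.2, algebraic form) Let K be an algebraically closed field, n ≥ 2, and let φ be a K-algebra automorphism of K[x_1,…,x_n] of degree d ≥ 2 that is not affine. Then there exists a K[t]-algebra automorphism Φ of K[t][x_1,…,x_n] whose components have degree at most d in x_1,…,x_n, such that for every t_0 ∈ K× the specialization of Φ at t = t_0 belongs to the subgroup of automorphisms of K[x_1,…,x_n] generated by the affine automorphisms together with φ, and the specialization of Φ at t = 0 is a triangular automorphism that is not affine. -/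
open MvPolynomial

/-- An automorphism of `K[x_1,…,x_n]` is affine if every component has total degree `≤ 1`. -/
def IsAffineAut {K : Type*} [Field K] {n : ℕ}
    (ψ : MvPolynomial (Fin n) K ≃ₐ[K] MvPolynomial (Fin n) K) : Prop :=
  ∀ i, (ψ (X i)).totalDegree ≤ 1

/-- An automorphism of `K[x_1,…,x_n]` is triangular if it has the form
`x_i ↦ α_i x_i + p_i` with `α_i ∈ K×` and `p_i ∈ K[x_{i+1},…,x_n]`. -/
def IsTriangularAut {K : Type*} [Field K] {n : ℕ}
    (ψ : MvPolynomial (Fin n) K ≃ₐ[K] MvPolynomial (Fin n) K) : Prop :=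
  ∀ i, ∃ (α : Kˣ) (p : MvPolynomial (Fin n) K),
    p ∈ MvPolynomial.supported K {j : Fin n | i < j} ∧ ψ (X i) = C (α : K) * X i + p


namespace Degen

section ideal
variable {σ K : Type*} [Field K]

/-- The ideal of polynomials all of whose monomials have `w`-weight at least `k`. -/
def W (w : σ → ℕ) (k : ℕ) : Ideal (MvPolynomial σ K) where
  carrier := {f | ∀ m, coeff m f ≠ 0 → k ≤ Finsupp.weight w m}
  zero_mem' := by intro m hm; simp at hm
  add_mem' := by
    intro a b ha hb m hm
    by_cases h : coeff m a = 0
    · exact hb m (by simpa [h] using hm)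
    · exact ha m h
  smul_mem' := by
    classical
    intro c f hf m hm
    rw [smul_eq_mul, coeff_mul] at hm
    obtain ⟨x, hx, hne⟩ := Finset.exists_ne_zero_of_sum_ne_zero hm
    rw [Finset.HasAntidiagonal.mem_antidiagonal] at hx
    have := hf x.2 (right_ne_zero_of_mul hne)
    rw [← hx, map_add]
    omega

lemma mem_W {w : σ → ℕ} {k : ℕ} {f : MvPolynomial σ K} :
    f ∈ W w k ↔ ∀ m, coeff m f ≠ 0 → k ≤ Finsupp.weight w m := Iff.rfl

lemma W_mul {w : σ → ℕ} {a b : ℕ} {f g : MvPolynomial σ K} (hf : f ∈ W w a) (hg : g ∈ W w b) :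
    f * g ∈ W w (a + b) := by
  classical
  intro m hm
  rw [coeff_mul] at hm
  obtain ⟨x, hx, hne⟩ := Finset.exists_ne_zero_of_sum_ne_zero hm
  rw [Finset.HasAntidiagonal.mem_antidiagonal] at hx
  have := hf x.1 (left_ne_zero_of_mul hne)
  have := hg x.2 (right_ne_zero_of_mul hne)
  rw [← hx, map_add]
  omega

lemma W_anti {w : σ → ℕ} {a b : ℕ} (h : a ≤ b) {f : MvPolynomial σ K} (hf : f ∈ W w b) :
    f ∈ W w a := fun m hm => h.trans (hf m hm)

lemma W_zero {w : σ → ℕ} (f : MvPolynomial σ K) : f ∈ W w 0 := fun _ _ => Nat.zero_le _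

lemma X_mem_W {w : σ → ℕ} (i : σ) : (X i : MvPolynomial σ K) ∈ W w (w i) := by
  classical
  intro m hm
  rw [coeff_X] at hm
  have : Finsupp.single i 1 = m := by by_contra h; simp [h] at hm
  simp [← this, Finsupp.weight_single]

lemma W_pow {w : σ → ℕ} {a : ℕ} {f : MvPolynomial σ K} (hf : f ∈ W w a) (e : ℕ) :
    f ^ e ∈ W w (e * a) := by
  induction e with
  | zero => simpa using W_zero _
  | succ e ih => rw [pow_succ, Nat.succ_mul]; exact W_mul ih hf

lemma W_prod {w : σ → ℕ} {ι : Type*} (s : Finset ι) (a : ι → ℕ) (f : ι → MvPolynomial σ K)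
    (h : ∀ i ∈ s, f i ∈ W w (a i)) : ∏ i ∈ s, f i ∈ W w (∑ i ∈ s, a i) := by
  classical
  induction s using Finset.induction_on with
  | empty => simpa using W_zero _
  | insert i s hi ih =>
    rw [Finset.prod_insert hi, Finset.sum_insert hi]
    exact W_mul (h i (Finset.mem_insert_self _ _))
      (ih fun j hj => h j (Finset.mem_insert_of_mem hj))

lemma map_W {w : σ → ℕ} (ρ : MvPolynomial σ K →ₐ[K] MvPolynomial σ K)
    (h : ∀ i, ρ (X i) ∈ W w (w i)) {k : ℕ} {f : MvPolynomial σ K} (hf : f ∈ W w k) :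
    ρ f ∈ W w k := by
  rw [f.as_sum, map_sum]
  refine Ideal.sum_mem _ fun m hm => ?_
  rw [mem_support_iff] at hm
  refine W_anti (hf m hm) ?_
  rw [monomial_eq, map_mul, Finsupp.prod, map_prod, Finsupp.weight_apply, Finsupp.sum]
  refine Ideal.mul_mem_left _ _ (W_prod _ _ _ fun i _ => ?_)
  rw [map_pow, smul_eq_mul]
  exact W_pow (h i) _

lemma symm_mem {R : Type*} [CommRing R] [IsNoetherianRing R] (e : R ≃+* R) (I : Ideal R)
    (h : ∀ x ∈ I, e x ∈ I) : ∀ x ∈ I, e.symm x ∈ I := by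
  let J : ℕ →o Ideal R :=
    { toFun := fun k => Ideal.comap ((e ^ k : RingAut R) : R ≃+* R) I
      monotone' := by
        refine monotone_nat_of_le_succ fun k x hx => ?_
        rw [Ideal.mem_comap] at hx ⊢
        rw [pow_succ']
        exact h _ hx }
  obtain ⟨k, hk⟩ := monotone_stabilizes_iff_noetherian.mpr ‹IsNoetherianRing R› J
  have hk1 := hk (k+1) (Nat.le_succ k)
  intro x hx
  let E : RingAut R := e
  have h1 : (E ^ k)⁻¹ (E⁻¹ x) ∈ J (k+1) := by
    change (E ^ (k+1)) ((E ^ k)⁻¹ (E⁻¹ x)) ∈ I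
    rw [← RingAut.mul_apply, ← RingAut.mul_apply]
    have : E ^ (k+1) * (E^k)⁻¹ * E⁻¹ = 1 := by group
    rw [this]; exact hx
  rw [← hk1] at h1
  change (E ^ k) ((E ^ k)⁻¹ (E⁻¹ x)) ∈ I at h1
  rw [← RingAut.mul_apply, mul_inv_cancel] at h1
  exact h1

lemma symm_map_W [Finite σ] {w : σ → ℕ} (F : MvPolynomial σ K ≃ₐ[K] MvPolynomial σ K)
    (h : ∀ i, F (X i) ∈ W w (w i)) (i : σ) : F.symm (X i) ∈ W w (w i) :=
  symm_mem F.toRingEquiv (W w (w i)) (fun _ hx => map_W (F : _ →ₐ[K] _) h hx) _ (X_mem_W i)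

end ideal

section theta
variable {σ K : Type*} [Field K]

/-- The substitution `x_i ↦ t^{w_i} x_i`. -/
noncomputable def theta (w : σ → ℕ) : MvPolynomial σ K →ₐ[K] MvPolynomial σ (Polynomial K) :=
  aeval fun i => C (Polynomial.X ^ w i) * X i

lemma coeff_theta (w : σ → ℕ) (f : MvPolynomial σ K) (m : σ →₀ ℕ) :
    coeff m (theta w f) = Polynomial.C (coeff m f) * Polynomial.X ^ (Finsupp.weight w m) := by
  classical
  induction f using MvPolynomial.induction_on' with
  | add p q hp hq => simp [hp, hq, add_mul]
  | monomial s a =>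
    have : theta w (monomial s a) =
        monomial s (Polynomial.C a * Polynomial.X ^ (Finsupp.weight w s)) := by
      rw [theta, aeval_monomial, monomial_eq (a := _ * _)]
      simp only [Finsupp.prod, mul_pow, Finset.prod_mul_distrib, Finsupp.weight_apply,
        Finsupp.sum, C_mul, smul_eq_mul, ← C_pow, ← pow_mul]
      rw [mul_assoc, ← map_prod, Finset.prod_pow_eq_pow_sum,
        Finset.sum_congr rfl fun i _ => mul_comm (w i) (s i)]
      rfl
    rw [this, coeff_monomial, coeff_monomial]
    split_ifs with h
    · rw [h]
    · simp

lemma exists_theta {w : σ → ℕ} {k : ℕ} {f : MvPolynomial σ K} (hf : f ∈ W w k) :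
    ∃ q, theta w f = C (Polynomial.X ^ k) * q := by
  change C (Polynomial.X ^ k) ∣ theta w f
  rw [C_dvd_iff_dvd_coeff]
  intro m
  rw [coeff_theta]
  by_cases h : coeff m f = 0
  · simp [h]
  · exact Dvd.dvd.mul_left (pow_dvd_pow _ (hf m h)) _

lemma coeff_quot {w : σ → ℕ} {k : ℕ} {f : MvPolynomial σ K} (hf : f ∈ W w k)
    {q : MvPolynomial σ (Polynomial K)} (hq : theta w f = C (Polynomial.X ^ k) * q)
    (m : σ →₀ ℕ) :
    coeff m q = Polynomial.C (coeff m f) * Polynomial.X ^ (Finsupp.weight w m - k) := by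
  have h1 := congrArg (coeff m) hq
  rw [coeff_theta, coeff_C_mul] at h1
  have h0 : (Polynomial.X ^ k : Polynomial K) ≠ 0 := pow_ne_zero _ Polynomial.X_ne_zero
  apply mul_left_cancel₀ h0
  rw [← h1]
  by_cases h : coeff m f = 0
  · simp [h]
  · have := hf m h
    rw [mul_left_comm, ← pow_add, Nat.add_sub_cancel' this]

lemma coeff_quot_zero {w : σ → ℕ} {k : ℕ} {f : MvPolynomial σ K} (hf : f ∈ W w k)
    {q : MvPolynomial σ (Polynomial K)} (hq : theta w f = C (Polynomial.X ^ k) * q)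
    (m : σ →₀ ℕ) :
    coeff m (MvPolynomial.map (Polynomial.evalRingHom (0 : K)) q) =
      if Finsupp.weight w m = k then coeff m f else 0 := by
  rw [coeff_map, coeff_quot hf hq]
  by_cases h : coeff m f = 0
  · simp [h]
  · have := hf m h
    split_ifs with h2
    · simp [h2]
    · have : Finsupp.weight w m - k ≠ 0 := by omega
      simp [this]

lemma totalDegree_quot {w : σ → ℕ} {k : ℕ} {f : MvPolynomial σ K} (hf : f ∈ W w k)
    {q : MvPolynomial σ (Polynomial K)} (hq : theta w f = C (Polynomial.X ^ k) * q) :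
    q.totalDegree ≤ f.totalDegree := by
  apply Finset.sup_mono
  intro m hm
  rw [mem_support_iff] at hm ⊢
  intro h
  rw [coeff_quot hf hq, h] at hm
  simp at hm

lemma exists_Phi [Finite σ] {w : σ → ℕ} (F : MvPolynomial σ K ≃ₐ[K] MvPolynomial σ K)
    (h : ∀ i, F (X i) ∈ W w (w i)) :
    ∃ Φ : MvPolynomial σ (Polynomial K) ≃ₐ[Polynomial K] MvPolynomial σ (Polynomial K),
      ∀ i, theta w (F (X i)) = C (Polynomial.X ^ w i) * Φ (X i) := by
  choose q hq using fun i => exists_theta (h i)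
  choose r hr using fun i => exists_theta (symm_map_W F h i)
  have key : ∀ (G : MvPolynomial σ K ≃ₐ[K] MvPolynomial σ K) (q : σ → MvPolynomial σ (Polynomial K)),
      (∀ i, theta w (G (X i)) = C (Polynomial.X ^ w i) * q i) →
      ∀ f, aeval (R := Polynomial K) q (theta w f) = theta w (G f) := by
    intro G q hq f
    have : ((aeval (R := Polynomial K) q).restrictScalars K).comp (theta w)
        = (theta w).comp (G : _ →ₐ[K] _) := by
      ext1 i
      simp [hq]
      simp [theta, algebraMap_eq]
    exact DFunLike.congr_fun this f
  have key2 : ∀ (G H : MvPolynomial σ K ≃ₐ[K] MvPolynomial σ K)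
      (q r : σ → MvPolynomial σ (Polynomial K)),
      (∀ i, theta w (G (X i)) = C (Polynomial.X ^ w i) * q i) →
      (∀ i, theta w (H (X i)) = C (Polynomial.X ^ w i) * r i) →
      (∀ f, G (H f) = f) →
      (aeval (R := Polynomial K) q).comp (aeval r) = AlgHom.id _ _ := by
    intro G H q r hq hr hGH
    ext1 i
    have h1 := key G q hq (theta w (H (X i))  |> fun _ => H (X i))
    simp only [hGH, hr] at h1
    have h0 : (C (Polynomial.X ^ w i) : MvPolynomial σ (Polynomial K)) ≠ 0 := by
      rw [Ne, C_eq_zero]; exact pow_ne_zero _ Polynomial.X_ne_zero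
    apply mul_left_cancel₀ h0
    rw [map_mul] at h1
    simpa [theta, algebraMap_eq] using h1
  refine ⟨AlgEquiv.ofAlgHom (aeval q) (aeval r) (key2 F F.symm q r hq hr (by simp))
    (key2 F.symm F r q hr hq (by simp)), fun i => ?_⟩
  simp [hq]

lemma spec_comm {σ K : Type*} [Field K] (ev : Polynomial K →+* K)
    (Φ : MvPolynomial σ (Polynomial K) →ₐ[Polynomial K] MvPolynomial σ (Polynomial K))
    (p : MvPolynomial σ (Polynomial K)) :
    MvPolynomial.map ev (Φ p) =
      aeval (R := K) (fun i => MvPolynomial.map ev (Φ (X i))) (MvPolynomial.map ev p) := by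
  induction p using MvPolynomial.induction_on with
  | C a => 
    have : Φ (C a) = C a := Φ.commutes a
    simp [this, algebraMap_eq]
  | add p q hp hq => simp [hp, hq]
  | mul_X p i hp => simp [hp]

lemma exists_spec {σ K : Type*} [Field K] (ev : Polynomial K →+* K)
    (Φ : MvPolynomial σ (Polynomial K) ≃ₐ[Polynomial K] MvPolynomial σ (Polynomial K)) :
    ∃ ψ : MvPolynomial σ K ≃ₐ[K] MvPolynomial σ K,
      ∀ i, ψ (X i) = MvPolynomial.map ev (Φ (X i)) := by
  refine ⟨AlgEquiv.ofAlgHom (aeval fun i => MvPolynomial.map ev (Φ (X i)))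
    (aeval fun i => MvPolynomial.map ev (Φ.symm (X i))) ?_ ?_, fun i => ?_⟩
  · ext1 i
    have := spec_comm ev (Φ : _ →ₐ[Polynomial K] _) (Φ.symm (X i))
    simpa using this.symm
  · ext1 i
    have := spec_comm ev (Φ.symm : _ →ₐ[Polynomial K] _) (Φ (X i))
    simpa using this.symm
  · simp

/-- Diagonal scaling. -/
noncomputable def scale (c : σ → Kˣ) : MvPolynomial σ K ≃ₐ[K] MvPolynomial σ K :=
  AlgEquiv.ofAlgHom (aeval fun i => C (c i : K) * X i) (aeval fun i => C ((c i)⁻¹ : K) * X i)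
    (by ext1 i; simp [algebraMap_eq, ← mul_assoc, ← C_mul])
    (by ext1 i; simp [algebraMap_eq, ← mul_assoc, ← C_mul])

lemma scale_X (c : σ → Kˣ) (i : σ) : scale c (X i : MvPolynomial σ K) = C (c i : K) * X i := by
  simp [scale]

lemma spec_ne_zero {w : σ → ℕ} (F : MvPolynomial σ K ≃ₐ[K] MvPolynomial σ K)
    (Φ : MvPolynomial σ (Polynomial K) ≃ₐ[Polynomial K] MvPolynomial σ (Polynomial K))
    (h : ∀ i, theta w (F (X i)) = C (Polynomial.X ^ w i) * Φ (X i)) (t : Kˣ) (i : σ) :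
    (scale (fun i => t ^ w i) * F * (scale (fun i => t ^ w i))⁻¹) (X i) =
      MvPolynomial.map (Polynomial.evalRingHom (t : K)) (Φ (X i)) := by
  set S : MvPolynomial σ K ≃ₐ[K] MvPolynomial σ K := scale (fun i => t ^ w i) with hS
  have h1 : ∀ f, MvPolynomial.map (Polynomial.evalRingHom (t : K)) (theta w f) = S f := by
    intro f
    induction f using MvPolynomial.induction_on with
    | C a =>
      have : S (C a) = C a := S.commutes a
      rw [this]
      simp only [theta, algHom_C]
      change MvPolynomial.map _ (C (Polynomial.C a)) = _
      simp
    | add p q hp hq => simp [hp, hq]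
    | mul_X p i hp => 
      rw [map_mul, map_mul, hp, map_mul, hS, scale_X]
      simp [theta]
  have h2 : S⁻¹ (X i) = C (((t : K) ^ w i)⁻¹) * X i := by
    change S.symm (X i) = _
    rw [AlgEquiv.symm_apply_eq, map_mul, hS, scale_X]
    have : scale (fun i => t ^ w i) (C (((t : K) ^ w i)⁻¹) : MvPolynomial σ K) = C _ :=
      (scale (fun i => t ^ w i)).commutes _
    rw [this, ← mul_assoc, ← C_mul]
    simp
  have h3 := congrArg (MvPolynomial.map (Polynomial.evalRingHom (t : K))) (h i)
  rw [h1] at h3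
  rw [AlgEquiv.mul_apply, AlgEquiv.mul_apply, h2, map_mul, map_mul, h3]
  have h4 : ∀ G : MvPolynomial σ K ≃ₐ[K] MvPolynomial σ K, ∀ a : K, G (C a) = C a :=
    fun G a => G.commutes a
  rw [h4, h4, map_mul, map_C, ← mul_assoc, ← C_mul]
  simp

end theta

section affine
variable {K : Type*} [Field K] {N : ℕ}

lemma aut_C {σ : Type*} (G : MvPolynomial σ K ≃ₐ[K] MvPolynomial σ K) (a : K) : G (C a) = C a :=
  G.commutes a

/-- Linear substitution by a matrix. -/
noncomputable def linHom (P : Matrix (Fin N) (Fin N) K) :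
    MvPolynomial (Fin N) K →ₐ[K] MvPolynomial (Fin N) K :=
  aeval fun i => ∑ j, C (P i j) * X j

lemma linHom_X (P : Matrix (Fin N) (Fin N) K) (i : Fin N) :
    linHom P (X i) = ∑ j, C (P i j) * X j := by simp [linHom]

lemma linHom_comp (P Q : Matrix (Fin N) (Fin N) K) (h : Q * P = 1) :
    (linHom P).comp (linHom Q) = AlgHom.id K _ := by
  ext1 i
  have h1 : ∀ k, ∑ j, Q i j * P j k = if i = k then 1 else 0 := by
    intro k
    rw [← Matrix.mul_apply, h, Matrix.one_apply]
  simp only [AlgHom.comp_apply, linHom_X, map_sum, map_mul, AlgHom.id_apply, algHom_C,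
    algebraMap_eq, Finset.mul_sum]
  rw [Finset.sum_comm]
  simp only [← mul_assoc, ← C_mul, ← Finset.sum_mul]
  simp only [← map_sum, h1]
  simp

/-- Linear automorphism attached to an invertible matrix. -/
noncomputable def lin (P Q : Matrix (Fin N) (Fin N) K) (h : P * Q = 1) :
    MvPolynomial (Fin N) K ≃ₐ[K] MvPolynomial (Fin N) K :=
  AlgEquiv.ofAlgHom (linHom P) (linHom Q) (linHom_comp P Q (mul_eq_one_comm.mp h))
    (linHom_comp Q P h)

lemma lin_X (P Q : Matrix (Fin N) (Fin N) K) (h : P * Q = 1) (i : Fin N) :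
    lin P Q h (X i) = ∑ j, C (P i j) * X j := by simp [lin, linHom_X]

lemma totalDegree_lc {d : ℕ} (a : Fin N → K) (f : Fin N → MvPolynomial (Fin N) K)
    (h : ∀ i, (f i).totalDegree ≤ d) : (∑ j, C (a j) * f j).totalDegree ≤ d := by
  refine totalDegree_finsetSum_le fun i _ => ?_
  refine (totalDegree_mul _ _).trans ?_
  simpa using h i

lemma lin_affine (P Q : Matrix (Fin N) (Fin N) K) (h : P * Q = 1) : IsAffineAut (lin P Q h) := by
  intro i
  rw [lin_X]
  exact totalDegree_lc _ _ fun i => by simp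

/-- Translation. -/
noncomputable def trans (c : Fin N → K) :
    MvPolynomial (Fin N) K ≃ₐ[K] MvPolynomial (Fin N) K :=
  AlgEquiv.ofAlgHom (aeval fun i => X i - C (c i)) (aeval fun i => X i + C (c i))
    (by ext1 i; simp [algebraMap_eq]) (by ext1 i; simp [algebraMap_eq])

lemma trans_X (c : Fin N → K) (i : Fin N) :
    trans c (X i) = X i - C (c i) := by simp [trans]

lemma trans_affine (c : Fin N → K) : IsAffineAut (trans c) := by
  intro i
  rw [trans_X]
  exact (totalDegree_sub_C_le _ _).trans (by simp)

lemma scale_affine (c : Fin N → Kˣ) : IsAffineAut (scale c) := by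
  intro i
  rw [scale_X]
  refine (totalDegree_mul _ _).trans ?_
  simp

lemma totalDegree_subst {σ : Type*} (ρ : MvPolynomial σ K →ₐ[K] MvPolynomial σ K)
    (h : ∀ i, (ρ (X i)).totalDegree ≤ 1) (f : MvPolynomial σ K) :
    (ρ f).totalDegree ≤ f.totalDegree := by
  conv_lhs => rw [f.as_sum, map_sum]
  refine totalDegree_finsetSum_le fun m hm => ?_
  refine le_trans ?_ (le_totalDegree hm)
  rw [monomial_eq, map_mul, Finsupp.prod, map_prod, Finsupp.sum]
  refine (totalDegree_mul _ _).trans ?_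
  rw [algHom_C, algebraMap_eq, totalDegree_C, zero_add]
  refine (totalDegree_finsetProd _ _).trans (Finset.sum_le_sum fun i _ => ?_)
  rw [map_pow]
  refine (totalDegree_pow _ _).trans ?_
  calc _ ≤ m i * 1 := Nat.mul_le_mul_left _ (h i)
    _ = m i := mul_one _

lemma coeff_single_mul {σ : Type*} [DecidableEq σ] (f g : MvPolynomial σ K) (j : σ) :
    coeff (Finsupp.single j 1) (f * g) =
      coeff 0 f * coeff (Finsupp.single j 1) g + coeff (Finsupp.single j 1) f * coeff 0 g := by
  rw [coeff_mul, Finsupp.antidiagonal_single]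
  simp [Finset.Nat.antidiagonal_succ]

lemma chain (ρ : MvPolynomial (Fin N) K →ₐ[K] MvPolynomial (Fin N) K)
    (h : ∀ f, coeff 0 (ρ f) = coeff 0 f) (f : MvPolynomial (Fin N) K) (j : Fin N) :
    coeff (Finsupp.single j 1) (ρ f) =
      ∑ k, coeff (Finsupp.single k 1) f * coeff (Finsupp.single j 1) (ρ (X k)) := by
  classical
  induction f using MvPolynomial.induction_on with
  | C a =>
    simp only [algHom_C, algebraMap_eq, coeff_C]
    have : ∀ k : Fin N, (0 : Fin N →₀ ℕ) ≠ Finsupp.single k 1 := by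
      intro k h
      have := DFunLike.congr_fun h k
      simp at this
    simp [this]
  | add p q hp hq => simp [hp, hq, add_mul, Finset.sum_add_distrib]
  | mul_X p i hp =>
    rw [map_mul, coeff_single_mul, h, h, hp]
    simp only [coeff_single_mul, coeff_X, add_mul, Finset.sum_add_distrib]
    have : ∀ k : Fin N, (Finsupp.single i 1 : Fin N →₀ ℕ) = Finsupp.single k 1 ↔ i = k := by
      intro k
      exact Finsupp.single_left_inj one_ne_zero
    simp [this]

lemma coeff_zero_aut (ρ : MvPolynomial (Fin N) K →ₐ[K] MvPolynomial (Fin N) K)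
    (h : ∀ i, coeff 0 (ρ (X i)) = 0) (f : MvPolynomial (Fin N) K) :
    coeff 0 (ρ f) = coeff 0 f := by
  induction f using MvPolynomial.induction_on with
  | C a => simp [algebraMap_eq]
  | add p q hp hq => simp [hp, hq]
  | mul_X p i hp =>
    have h' := h i
    rw [← constantCoeff_eq] at h' 
    simp only [← constantCoeff_eq, map_mul, h', constantCoeff_X, mul_zero]

lemma degree_le_one {σ : Type*} (m : σ →₀ ℕ) (h : Finsupp.weight (fun _ => 1) m < 2) :
    m = 0 ∨ ∃ j, m = Finsupp.single j 1 := by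
  have h1 : Finsupp.weight (fun _ => 1) m = m.degree := by
    rw [Finsupp.degree_eq_weight_one]
  rw [h1] at h
  by_cases h0 : m.degree = 0
  · left; exact (Finsupp.degree_eq_zero_iff m).mp h0
  · right
    have : m.degree = 1 := by omega
    have h2 : m ∈ {d : σ →₀ ℕ | d.degree = 1} := this
    rw [← Finsupp.range_single_one] at h2
    obtain ⟨j, hj⟩ := h2
    exact ⟨j, hj.symm⟩

lemma mem_W2 {f : MvPolynomial (Fin N) K} (h0 : coeff 0 f = 0)
    (h1 : ∀ j, coeff (Finsupp.single j 1) f = 0) : f ∈ W (fun _ => 1) 2 := by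
  intro m hm
  by_contra hlt
  rcases degree_le_one m (by omega) with rfl | ⟨j, rfl⟩
  · exact hm h0
  · exact hm (h1 j)

lemma exists_normal (φ : MvPolynomial (Fin N) K ≃ₐ[K] MvPolynomial (Fin N) K) (d : ℕ)
    (hd : ∀ i, (φ (X i)).totalDegree ≤ d) (hna : ¬ IsAffineAut φ) :
    ∃ F ∈ Subgroup.closure ({a | IsAffineAut a} ∪ {φ}),
      (∀ i, (F (X i)).totalDegree ≤ d) ∧ (∀ i, F (X i) - X i ∈ W (fun _ => 1) 2) ∧
      ∃ i, F (X i) ≠ X i := by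
  classical
  set T : MvPolynomial (Fin N) K ≃ₐ[K] _ := trans fun i => coeff 0 (φ (X i)) with hT
  set E : MvPolynomial (Fin N) K ≃ₐ[K] MvPolynomial (Fin N) K := φ * T with hE
  have hEX : ∀ i, E (X i) = φ (X i) - C (coeff 0 (φ (X i))) := by
    intro i
    rw [hE, AlgEquiv.mul_apply, hT, trans_X, map_sub, aut_C]
  have hE0 : ∀ f, coeff 0 (E f) = coeff 0 f :=
    coeff_zero_aut (E : MvPolynomial (Fin N) K →ₐ[K] MvPolynomial (Fin N) K)
      (fun i => by
        change coeff 0 (E (X i)) = 0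
        simp [hEX])
  have hEs0 : ∀ f, coeff 0 (E.symm f) = coeff 0 f := by
    intro f
    rw [← hE0, AlgEquiv.apply_symm_apply]
  let A : Matrix (Fin N) (Fin N) K := fun i j => coeff (Finsupp.single j 1) (E (X i))
  let B : Matrix (Fin N) (Fin N) K := fun i j => coeff (Finsupp.single j 1) (E.symm (X i))
  have hone : ∀ i j : Fin N, coeff (Finsupp.single j 1) (X i : MvPolynomial (Fin N) K)
      = (1 : Matrix (Fin N) (Fin N) K) i j := by
    intro i j
    rw [coeff_X, Matrix.one_apply]
    simp [Finsupp.single_left_inj]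
  have hBA : B * A = 1 := by
    ext i j
    have := chain (E : _ →ₐ[K] _) hE0 (E.symm (X i)) j
    simp only [AlgEquiv.coe_toAlgHom, AlgEquiv.apply_symm_apply, hone] at this
    rw [this, Matrix.mul_apply]
  set L := lin B A hBA with hL
  have hF : ∀ i, (E * L) (X i) = ∑ j, C (B i j) * E (X j) := by
    intro i
    rw [AlgEquiv.mul_apply, hL, lin_X, map_sum]
    simp only [map_mul, aut_C]
  have hdE : ∀ i, (E (X i)).totalDegree ≤ d := fun i => by
    rw [hEX]; exact (totalDegree_sub_C_le _ _).trans (hd i)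
  refine ⟨E * L, ?_, ?_, ?_, ?_⟩
  · refine mul_mem (mul_mem (Subgroup.subset_closure (Or.inr rfl))
      (Subgroup.subset_closure (Or.inl (trans_affine _))))
      (Subgroup.subset_closure (Or.inl (lin_affine _ _ _)))
  · intro i
    rw [hF]
    exact totalDegree_lc _ _ hdE
  · intro i
    apply mem_W2
    · rw [coeff_sub, hF, coeff_sum]
      simp [coeff_C_mul, hE0]
    · intro j
      rw [coeff_sub, hF, coeff_sum, hone, ← hBA, Matrix.mul_apply]
      simp [coeff_C_mul, A]
  · by_contra! hcon
    apply hna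
    intro i
    have h1 : φ (X i) = (E * L) (L.symm (X i)) + C (coeff 0 (φ (X i))) := by
      rw [AlgEquiv.mul_apply, AlgEquiv.apply_symm_apply, hEX]; ring
    have h2 : L.symm (X i) = ∑ j, C (A i j) * X j := by
      rw [AlgEquiv.symm_apply_eq, map_sum]
      have := linHom_comp B A (mul_eq_one_comm.mp hBA)
      have := DFunLike.congr_fun this (X i)
      simp only [AlgHom.comp_apply, linHom_X, AlgHom.id_apply] at this
      rw [← this, map_sum]
      rfl
    rw [h1, h2, map_sum]
    refine (totalDegree_add _ _).trans ?_
    rw [totalDegree_C, max_eq_left (Nat.zero_le _)]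
    simp only [map_mul, aut_C, hcon]
    exact totalDegree_lc _ _ fun i => by simp

lemma exists_matrix (l : Fin (N + 2) → K) (hl : l ≠ 0) :
    ∃ P Q : Matrix (Fin (N + 2)) (Fin (N + 2)) K, P * Q = 1 ∧ P 0 = l := by
  obtain ⟨k, hk⟩ := Function.ne_iff.mp hl
  let M : Matrix (Fin (N + 2)) (Fin (N + 2)) K := Matrix.updateRow 1 k l
  have hM : M.det = l k := by
    rw [← Matrix.cramer_transpose_apply]
    simp
  let P := M.submatrix (Equiv.swap 0 k) id
  have hP : IsUnit P.det := by
    rw [Matrix.det_permute, hM, isUnit_iff_ne_zero]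
    refine mul_ne_zero ?_ hk
    rcases Int.units_eq_one_or (Equiv.Perm.sign (Equiv.swap 0 k)) with h | h <;> simp [h]
  refine ⟨P, P⁻¹, Matrix.mul_nonsing_inv _ hP, ?_⟩
  ext j
  simp [P, M]

lemma exists_vec [Infinite K] {n : ℕ}
    (F : MvPolynomial (Fin (n + 2)) K ≃ₐ[K] MvPolynomial (Fin (n + 2)) K)
    (hF : ∀ i, F (X i) - X i ∈ W (fun _ => 1) 2) (hne : ∃ i, F (X i) ≠ X i) :
    ∃ (v l : Fin (n + 2) → K), ∑ j, l j * v j = 0 ∧ ∑ j, l j * eval v (F (X j)) ≠ 0 := by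
  classical
  by_cases h : ∀ i j, X j * F (X i) = X i * F (X j)
  · exfalso
    have h01 := h 0 1
    have hdvd : (X 0 : MvPolynomial (Fin (n + 2)) K) ∣ F (X 0) := by
      have : (X 0 : MvPolynomial (Fin (n + 2)) K) ∣ X 1 * F (X 0) := ⟨_, h01⟩
      rcases (X_prime (i := (0 : Fin (n + 2))) (R := K)).dvd_or_dvd this with h | h
      · rw [X_dvd_X] at h
        simp at h
      · exact h
    obtain ⟨g, hg⟩ := hdvd
    have hirr : Irreducible (F (X 0)) :=
      (MulEquiv.irreducible_iff F.toMulEquiv).mpr (X_prime (i := (0 : Fin (n + 2))) (R := K)).irreducible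
    have hu : IsUnit g := by
      rcases hirr.isUnit_or_isUnit hg with h | h
      · exact absurd h (X_prime (i := (0 : Fin (n + 2))) (R := K)).not_isUnit
      · exact h
    rw [isUnit_iff_eq_C_of_isReduced] at hu
    obtain ⟨c, hc, rfl⟩ := hu
    have hc1 : c = 1 := by
      by_contra hc1
      have := hF 0 (Finsupp.single 0 1) (by
        rw [hg, coeff_sub, mul_comm, coeff_C_mul, coeff_X]
        simpa [sub_eq_zero] using hc1)
      simp [Finsupp.weight_single] at this
    subst hc1
    obtain ⟨i, hi⟩ := hne
    apply hi
    have := h 0 i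
    rw [hg, C_1, mul_one, mul_comm] at this
    exact (mul_left_cancel₀ (X_ne_zero _) this).symm
  · push Not at h
    obtain ⟨i, j, hij⟩ := h
    obtain ⟨v, hv⟩ : ∃ v, eval v (X j * F (X i)) ≠ eval v (X i * F (X j)) := by
      by_contra! hcon
      exact hij (MvPolynomial.funext hcon)
    refine ⟨v, fun k => (if k = i then v j else 0) - (if k = j then v i else 0), ?_, ?_⟩
    · simp only [sub_mul, Finset.sum_sub_distrib, ite_mul, zero_mul, Finset.sum_ite_eq',
        Finset.mem_univ, if_true]
      ring
    · simpa [sub_mul, Finset.sum_sub_distrib, sub_eq_zero] using hv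

lemma exists_normal' [Infinite K] {n : ℕ}
    (φ : MvPolynomial (Fin (n + 2)) K ≃ₐ[K] MvPolynomial (Fin (n + 2)) K) (d : ℕ)
    (hd : ∀ i, (φ (X i)).totalDegree ≤ d) (hna : ¬ IsAffineAut φ) :
    ∃ F ∈ Subgroup.closure ({a | IsAffineAut a} ∪ {φ}),
      (∀ i, (F (X i)).totalDegree ≤ d) ∧ (∀ i, F (X i) - X i ∈ W (fun _ => 1) 2) ∧
      ∃ m, coeff m (F (X 0)) ≠ 0 ∧ m 0 = 0 := by
  classical
  obtain ⟨F, hFc, hFd, hF2, hFne⟩ := exists_normal φ d hd hna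
  obtain ⟨v, l, hlv, hlF⟩ := exists_vec F hF2 hFne
  obtain ⟨P, Q, hPQ, hP⟩ := exists_matrix l (by rintro rfl; simp at hlF)
  have hQP := mul_eq_one_comm.mp hPQ
  set S := lin Q P hQP with hS
  set R := lin P Q hPQ with hR
  have hX : ∀ i, (S * F * R) (X i) = S (∑ j, C (P i j) * F (X j)) := by
    intro i
    rw [AlgEquiv.mul_apply, AlgEquiv.mul_apply, hR, lin_X, map_sum]
    simp only [map_mul, aut_C]
  have hSR : ∀ i, S (∑ j, C (P i j) * X j) = X i := by
    intro i
    have := linHom_comp Q P hPQ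
    have := DFunLike.congr_fun this (X i)
    simp only [AlgHom.comp_apply, linHom_X, AlgHom.id_apply] at this
    exact this
  refine ⟨S * F * R, mul_mem (mul_mem (Subgroup.subset_closure (Or.inl (lin_affine _ _ _))) hFc)
    (Subgroup.subset_closure (Or.inl (lin_affine _ _ _))), ?_, ?_, ?_⟩
  · intro i
    rw [hX]
    exact (totalDegree_subst (S : MvPolynomial (Fin (n + 2)) K →ₐ[K] MvPolynomial (Fin (n + 2)) K)
      (fun i => lin_affine Q P hQP i) _).trans (totalDegree_lc _ _ hFd)
  · intro i
    rw [hX]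
    rw [← hSR i, ← map_sub, ← Finset.sum_sub_distrib]
    simp only [← mul_sub]
    refine map_W (S : _ →ₐ[K] _) (fun i => ?_)
      (Ideal.sum_mem _ fun j _ => Ideal.mul_mem_left _ _ (hF2 j))
    change S (X i) ∈ _
    rw [hS, lin_X]
    exact Ideal.sum_mem _ fun j _ => Ideal.mul_mem_left _ _ (X_mem_W (w := fun _ => 1) j)
  · by_contra! hcon
    apply hlF
    have hu : ∀ f, eval (P.mulVec v) (S f) = eval v f := by
      intro f
      induction f using MvPolynomial.induction_on with
      | C a => simp [aut_C]
      | add p q hp hq => simp [hp, hq]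
      | mul_X p i hp =>
        rw [map_mul, map_mul, hp, map_mul, hS, lin_X]
        congr 1
        simp only [map_sum, map_mul, eval_C, eval_X]
        change (Q.mulVec (P.mulVec v)) i = v i
        rw [Matrix.mulVec_mulVec, hQP, Matrix.one_mulVec]
    have hu0 : P.mulVec v 0 = 0 := by
      change ∑ j, P 0 j * v j = 0
      rw [hP, hlv]
    have h1 : eval (P.mulVec v) ((S * F * R) (X 0)) = ∑ j, l j * eval v (F (X j)) := by
      rw [hX, hu, hP]
      simp
    rw [← h1, eval_eq]
    refine Finset.sum_eq_zero fun m hm => ?_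
    rw [mem_support_iff] at hm
    have := hcon m hm
    rw [Finset.prod_eq_zero (i := 0) (Finsupp.mem_support_iff.mpr this), mul_zero]
    rw [hu0, zero_pow this]

end affine

section main
variable {K : Type*} [Field K] {n : ℕ}

lemma weight_formula (M : ℕ) (m : Fin (n + 2) →₀ ℕ) :
    ∃ r, Finsupp.weight (fun i : Fin (n + 2) => if i = 0 then M else 1) m = m 0 * M + r ∧
      Finsupp.weight (fun _ => 1) m = m 0 + r := by
  refine ⟨∑ i : Fin (n + 1), m i.succ, ?_, ?_⟩
  · rw [Finsupp.weight_eq_sum, Fin.sum_univ_succ]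
    simp [Fin.succ_ne_zero]
  · rw [Finsupp.weight_eq_sum, Fin.sum_univ_succ]
    simp

lemma coeff_low {F : MvPolynomial (Fin (n + 2)) K ≃ₐ[K] MvPolynomial (Fin (n + 2)) K}
    (hF2 : ∀ i, F (X i) - X i ∈ W (fun _ => 1) 2) (i : Fin (n + 2)) (m : Fin (n + 2) →₀ ℕ)
    (hm : Finsupp.weight (fun _ => 1) m < 2) : coeff m (F (X i)) = coeff m (X i) := by
  by_contra h
  have := hF2 i m (by rw [coeff_sub]; exact sub_ne_zero.mpr h)
  omega

lemma eq_single {σ : Type*} {m : σ →₀ ℕ} {i : σ}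
    (h : coeff m (X i : MvPolynomial σ K) ≠ 0) : m = Finsupp.single i 1 := by
  classical
  rw [coeff_X] at h
  by_contra h'
  exact h (if_neg fun h => h' h.symm)

end main

end Degen

/-- Corollary 2.2 (algebraic form): if `φ` is a non-affine automorphism of `K[x_1,…,x_n]`
(`n ≥ 2`, `K` algebraically closed) of degree `d ≥ 2`, then there is a `K[t]`-algebra
automorphism `Φ` of `K[t][x_1,…,x_n]` whose components have degree at most `d` in the
`x_i`, such that every specialization at `t₀ ∈ K×` lies in the subgroup generated by the
affine automorphisms together with `φ`, while the specialization at `t = 0` is a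
triangular automorphism which is not affine. -/
theorem exists_family_degenerating_to_triangular
    (K : Type*) [Field K] [IsAlgClosed K] (n : ℕ)
    (φ : MvPolynomial (Fin (n + 2)) K ≃ₐ[K] MvPolynomial (Fin (n + 2)) K)
    (d : ℕ) (hd2 : 2 ≤ d)
    (hdeg : d = Finset.univ.sup fun i => (φ (X i)).totalDegree)
    (hnotaff : ¬ IsAffineAut φ) :
    ∃ Φ : MvPolynomial (Fin (n + 2)) (Polynomial K) ≃ₐ[Polynomial K]
        MvPolynomial (Fin (n + 2)) (Polynomial K),
      (∀ i : Fin (n + 2), (Φ (X i)).totalDegree ≤ d) ∧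
      (∀ t0 : K, t0 ≠ 0 →
        ∃ ψ ∈ Subgroup.closure
            ({a : MvPolynomial (Fin (n + 2)) K ≃ₐ[K] MvPolynomial (Fin (n + 2)) K |
                IsAffineAut a} ∪ {φ}),
          ∀ i : Fin (n + 2), ψ (X i) = MvPolynomial.map (Polynomial.evalRingHom t0) (Φ (X i))) ∧
      (∃ ψ : MvPolynomial (Fin (n + 2)) K ≃ₐ[K] MvPolynomial (Fin (n + 2)) K,
        (∀ i : Fin (n + 2), ψ (X i)
            = MvPolynomial.map (Polynomial.evalRingHom (0 : K)) (Φ (X i))) ∧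
        IsTriangularAut ψ ∧ ¬ IsAffineAut ψ) := by
  classical
  obtain ⟨F, hFc, hFd, hF2, m₀, hm₀, hm₀0⟩ := Degen.exists_normal' φ d
    (fun i => by
      rw [hdeg]
      exact Finset.le_sup (f := fun i => (φ (X i)).totalDegree) (Finset.mem_univ i)) hnotaff
  have hex : ∃ k, ∃ m, coeff m (F (X 0)) ≠ 0 ∧ m 0 = 0 ∧ Finsupp.weight (fun _ => 1) m = k :=
    ⟨_, m₀, hm₀, hm₀0, rfl⟩
  obtain ⟨M, ⟨m₁, hm₁, hm₁0, hm₁M⟩, hmin⟩ : ∃ M, (∃ m, coeff m (F (X 0)) ≠ 0 ∧ m 0 = 0 ∧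
      Finsupp.weight (fun _ => 1) m = M) ∧ ∀ m, coeff m (F (X 0)) ≠ 0 → m 0 = 0 →
      M ≤ Finsupp.weight (fun _ => 1) m :=
    ⟨Nat.find hex, Nat.find_spec hex, fun m h1 h2 => Nat.find_min' hex ⟨m, h1, h2, rfl⟩⟩
  have hM2 : 2 ≤ M := by
    by_contra hlt
    have h1 := Degen.coeff_low hF2 0 m₁ (by omega)
    rw [h1] at hm₁
    have := Degen.eq_single hm₁
    rw [this] at hm₁0
    simp at hm₁0
  set w : Fin (n + 2) → ℕ := fun i => if i = 0 then M else 1 with hw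
  have hw0 : w 0 = M := by simp [hw]
  have hw1 : ∀ i, i ≠ 0 → w i = 1 := fun i hi => by simp [hw, hi]
  have hFW : ∀ i, F (X i) ∈ Degen.W w (w i) := by
    intro i m hm
    obtain ⟨r, hr1, hr2⟩ := Degen.weight_formula M m
    rw [hr1]
    by_cases hi : i = 0
    · subst hi
      rw [hw0]
      by_cases h0 : m 0 = 0
      · have := hmin m hm h0
        rw [hr2] at this
        rw [h0] at this ⊢
        omega
      · have : 1 * M ≤ m 0 * M := Nat.mul_le_mul_right _ (by omega)
        omega
    · rw [hw1 i hi]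
      by_contra hlt
      have h0 : m 0 * M = 0 := by omega
      have h0' : m 0 = 0 := by
        rcases Nat.mul_eq_zero.mp h0 with h | h
        · exact h
        · omega
      have h1 := Degen.coeff_low hF2 i m (by omega)
      rw [h1] at hm
      have h2 := Degen.eq_single hm
      rw [h2, Finsupp.weight_single] at hr2
      rw [← h2] at hr2
      simp at hr2
      omega
  obtain ⟨Φ, hΦ⟩ := Degen.exists_Phi F hFW
  refine ⟨Φ, fun i => (Degen.totalDegree_quot (hFW i) (hΦ i)).trans (hFd i), ?_, ?_⟩
  · intro t0 ht0
    have hs : Degen.scale (fun i => (Units.mk0 t0 ht0) ^ w i) ∈ Subgroup.closure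
        ({a : MvPolynomial (Fin (n + 2)) K ≃ₐ[K] MvPolynomial (Fin (n + 2)) K |
                IsAffineAut a} ∪ {φ}) :=
      Subgroup.subset_closure (Or.inl (Degen.scale_affine _))
    exact ⟨_, mul_mem (mul_mem hs hFc) (inv_mem hs),
      fun i => Degen.spec_ne_zero F Φ hΦ (Units.mk0 t0 ht0) i⟩
  · obtain ⟨ψ, hψ⟩ := Degen.exists_spec (Polynomial.evalRingHom (0 : K)) Φ
    have hc : ∀ i m, coeff m (ψ (X i)) =
        if Finsupp.weight w m = w i then coeff m (F (X i)) else 0 := fun i m => by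
      rw [hψ, Degen.coeff_quot_zero (hFW i) (hΦ i)]
    refine ⟨ψ, hψ, ?_, ?_⟩
    · intro i
      refine ⟨1, ψ (X i) - X i, ?_, by simp⟩
      have key : ∀ m, coeff m (ψ (X i) - X i) ≠ 0 → i = 0 ∧ m 0 = 0 := by
        intro m hm
        rw [coeff_sub, hc] at hm
        by_contra hcon
        apply hm
        obtain ⟨r, hr1, hr2⟩ := Degen.weight_formula M m
        split_ifs with h
        · rw [sub_eq_zero]
          apply Degen.coeff_low hF2
          rw [hr2]
          rw [hr1] at h
          by_cases hi : i = 0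
          · rw [hi, hw0] at h
            have h0 : m 0 ≠ 0 := fun h => hcon ⟨hi, h⟩
            have h1 : m 0 = 1 := by
              by_contra h1
              have : 2 * M ≤ m 0 * M := Nat.mul_le_mul_right _ (by omega)
              omega
            rw [h1] at h ⊢
            omega
          · rw [hw1 i hi] at h
            have h0 : m 0 = 0 := by
              by_contra h0
              have : 1 * M ≤ m 0 * M := Nat.mul_le_mul_right _ (by omega)
              omega
            rw [h0] at h ⊢
            omega
        · rw [zero_sub, neg_eq_zero]
          by_contra h1
          apply h
          rw [Degen.eq_single h1, Finsupp.weight_single]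
          simp
      rw [mem_supported]
      intro j hj
      rw [Finset.mem_coe, mem_vars] at hj
      obtain ⟨m, hm, hjm⟩ := hj
      obtain ⟨hi, h0⟩ := key m (mem_support_iff.mp hm)
      rw [Finsupp.mem_support_iff] at hjm
      change i < j
      rw [hi]
      refine Fin.pos_iff_ne_zero.mpr ?_
      rintro rfl
      exact hjm h0
    · intro haff
      have h1 := haff 0
      obtain ⟨r, hr1, hr2⟩ := Degen.weight_formula M m₁
      have h2 : coeff m₁ (ψ (X 0)) ≠ 0 := by
        rw [hc, if_pos]
        · exact hm₁
        · rw [hr1, hw0, hm₁0]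
          rw [hm₁0] at hr2
          omega
      have h3 := le_totalDegree (mem_support_iff.mpr h2)
      have h4 : (m₁.sum fun _ e => e) = Finsupp.weight (fun _ => 1) m₁ := by
        simp [Finsupp.weight_apply]
      omega
end

section
/- (Overring principle, instance used) Let K be a field and let f_1,…,f_n ∈ K[t][x_1,…,x_n]. Suppose that the K(t)-algebra endomorphism of K(t)[x_1,…,x_n] sending x_i ↦ f_i is an automorphism, and that the determinant of the Jacobian matrix (∂f_i/∂x_j) is a nonzero constant (an element of K×). Then the K[t]-algebra endomorphism of K[t][x_1,…,x_n] sending x_i ↦ f_i is a K[t]-algebra automorphism, i.e., its inverse also has components in K[t][x_1,…,x_n]. -/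
open MvPolynomial

/-- A polynomial with no constant and no linear part lies in the square of the variable ideal. -/
lemma op_mem_sq {A : Type*} [CommRing A] {n : ℕ} (p : MvPolynomial (Fin n) A)
    (h0 : constantCoeff p = 0) (h1 : ∀ j, constantCoeff (pderiv j p) = 0) :
    p ∈ idealOfVars (Fin n) A ^ 2 := by
  rw [mem_pow_idealOfVars_iff']
  intro x hx
  by_cases hx0 : x.degree = 0
  · rw [Finsupp.degree_eq_zero_iff] at hx0
    subst hx0
    exact h0
  · have hx1 : x.degree = 1 := by omega
    obtain ⟨j, rfl⟩ : ∃ j, x = Finsupp.single j 1 := by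
      have hne : x ≠ 0 := by
        rintro rfl
        simp at hx0
      obtain ⟨j, hj⟩ := Finsupp.support_nonempty_iff.mpr hne
      obtain ⟨c, rfl⟩ := le_iff_exists_add'.mp
        (show Finsupp.single j 1 ≤ x by
          have := Finsupp.mem_support_iff.mp hj
          rw [Finsupp.single_le_iff]; omega)
      refine ⟨j, ?_⟩
      have : c.degree = 0 := by
        rw [map_add, Finsupp.degree_single] at hx1
        omega
      rw [Finsupp.degree_eq_zero_iff] at this
      simp [this]
    have := h1 j
    rw [constantCoeff_eq, coeff_pderiv] at this
    simpa using this

/-- A substitution `x_i ↦ x_i + (order at least 2)` acts as the identity on leading forms. -/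
lemma op_step {A : Type*} [CommRing A] {n : ℕ} (g : Fin n → MvPolynomial (Fin n) A)
    (hg : ∀ i, g i - X i ∈ idealOfVars (Fin n) A ^ 2) (d : ℕ) (p : MvPolynomial (Fin n) A)
    (hp : p ∈ idealOfVars (Fin n) A ^ d) :
    aeval g p - p ∈ idealOfVars (Fin n) A ^ (d + 1) := by
  set m := idealOfVars (Fin n) A with hm
  have hX : ∀ i, (X i : MvPolynomial (Fin n) A) ∈ m := fun i => Ideal.subset_span ⟨i, rfl⟩
  have hgm : ∀ i, g i - X i ∈ m := fun i => Ideal.pow_le_self two_ne_zero (hg i)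
  have h0 : ∀ q, aeval g q - q ∈ m := by
    intro q
    induction q using MvPolynomial.induction_on with
    | C a => simp
    | add p q hp hq =>
      have := m.add_mem hp hq
      rw [map_add]
      convert this using 1
      ring
    | mul_X p i hp =>
      rw [map_mul, aeval_X]
      have := m.add_mem (m.mul_mem_right (g i) hp) (m.mul_mem_left p (hgm i))
      convert this using 1
      ring
  have h1 : ∀ q ∈ m, aeval g q - q ∈ m ^ 2 := by
    intro q hq
    induction hq using Submodule.span_induction with
    | mem x hx =>
      obtain ⟨i, rfl⟩ := hx
      simpa using hg i
    | zero => simp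
    | add x y _ _ hx hy =>
      have := (m ^ 2).add_mem hx hy
      rw [map_add]
      convert this using 1
      ring
    | smul a x hx' hx =>
      have hx'' : x ∈ m := hx'
      have := (m ^ 2).add_mem ((m ^ 2).mul_mem_left (aeval g a) hx)
        (show (aeval g a - a) * x ∈ m ^ 2 by
          rw [pow_two]; exact Ideal.mul_mem_mul (h0 a) hx'')
      rw [smul_eq_mul, map_mul]
      convert this using 1
      ring
  induction d generalizing p with
  | zero => simpa using h0 p
  | succ d ih =>
    rw [pow_succ] at hp
    induction hp using Submodule.mul_induction_on' with
    | mem_mul_mem q hq a ha =>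
      have hga : aeval g a ∈ m := by
        have := m.add_mem (h0 a) ha
        simpa using this
      have e1 : (aeval g q - q) * aeval g a ∈ m ^ (d + 1 + 1) := by
        rw [pow_succ]; exact Ideal.mul_mem_mul (ih q hq) hga
      have e2 : q * (aeval g a - a) ∈ m ^ (d + 1 + 1) := by
        rw [add_assoc, pow_add]; exact Ideal.mul_mem_mul hq (h1 a ha)
      have := (m ^ (d + 1 + 1)).add_mem e1 e2
      rw [map_mul]
      convert this using 1
      ring
    | add x _ y _ hx hy =>
      have := (m ^ (d + 1 + 1)).add_mem hx hy
      rw [map_add]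
      convert this using 1
      ring

lemma op_inj_unipotent {A : Type*} [CommRing A] {n : ℕ} (g : Fin n → MvPolynomial (Fin n) A)
    (hg : ∀ i, g i - X i ∈ idealOfVars (Fin n) A ^ 2) (p : MvPolynomial (Fin n) A)
    (hp : aeval g p = 0) : p = 0 := by
  have h : ∀ d, p ∈ idealOfVars (Fin n) A ^ d := by
    intro d
    induction d with
    | zero => simp
    | succ d ih =>
      have := op_step g hg d p ih
      rw [hp, zero_sub] at this
      exact neg_mem_iff.mp this
  ext x
  exact (mem_pow_idealOfVars_iff' _ _).mp (h (x.degree + 1)) x (Nat.lt_succ_self _)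

/-- Over any commutative ring, a substitution whose Jacobian determinant has invertible
constant term is injective. -/
lemma op_inj {A : Type*} [CommRing A] {n : ℕ} (f : Fin n → MvPolynomial (Fin n) A)
    (u : A) (hu : IsUnit u)
    (hjac : Matrix.det (Matrix.of fun i j : Fin n => pderiv j (f i)) = C u)
    (p : MvPolynomial (Fin n) A) (hp : aeval f p = 0) : p = 0 := by
  classical
  let M : Matrix (Fin n) (Fin n) A := Matrix.of fun i j => constantCoeff (pderiv j (f i))
  have hM : M.det = u := by
    have := congrArg constantCoeff hjac
    rw [RingHom.map_det, constantCoeff_C] at this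
    exact this
  have hMu : IsUnit M.det := hM ▸ hu
  have hNM : M⁻¹ * M = 1 := Matrix.nonsing_inv_mul _ hMu
  have hMN : M * M⁻¹ = 1 := Matrix.mul_nonsing_inv _ hMu
  let b : Fin n → A := fun i => constantCoeff (f i)
  let l : Fin n → MvPolynomial (Fin n) A := fun i => ∑ j, C (M⁻¹ i j) * (X j - C (b j))
  let l' : Fin n → MvPolynomial (Fin n) A := fun i => ∑ j, C (M i j) * X j + C (b i)
  let g : Fin n → MvPolynomial (Fin n) A := fun i => ∑ j, C (M⁻¹ i j) * (f j - C (b j))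
  have hll : ∀ q, aeval l (aeval l' q) = q := by
    intro q
    have : (aeval l : MvPolynomial (Fin n) A →ₐ[A] MvPolynomial (Fin n) A).comp
        (aeval l' : MvPolynomial (Fin n) A →ₐ[A] MvPolynomial (Fin n) A) = AlgHom.id A (MvPolynomial (Fin n) A) := by
      ext1 i
      simp only [AlgHom.comp_apply, aeval_X, l', map_add, map_sum, map_mul, l, AlgHom.id_apply,
        algHom_C, algebraMap_eq]
      have : ∀ k, ∑ j, C (M i j) * (C (M⁻¹ j k) * (X k - C (b k))) =
          C ((M * M⁻¹) i k) * (X k - C (b k) : MvPolynomial (Fin n) A) := by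
        intro k
        rw [Matrix.mul_apply, map_sum, Finset.sum_mul]
        simp [mul_assoc]
      simp_rw [Finset.mul_sum]
      rw [Finset.sum_comm]
      simp_rw [this, hMN, Matrix.one_apply]
      simp
    exact DFunLike.congr_fun this q
  have hfl : ∀ q : MvPolynomial (Fin n) A, aeval f (aeval l q) = aeval g q := by
    intro q
    have : (aeval f : MvPolynomial (Fin n) A →ₐ[A] MvPolynomial (Fin n) A).comp
        (aeval l : MvPolynomial (Fin n) A →ₐ[A] MvPolynomial (Fin n) A) = aeval g := by
      ext1 i
      simp [l, g, algHom_C]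
    exact DFunLike.congr_fun this q
  have hg : ∀ i, g i - X i ∈ idealOfVars (Fin n) A ^ 2 := by
    intro i
    apply op_mem_sq
    · simp [g, b]
    · intro k
      have : (M⁻¹ * M) i k = (1 : Matrix (Fin n) (Fin n) A) i k := by rw [hNM]
      rw [Matrix.mul_apply] at this
      simp only [g, map_sub, map_sum, pderiv_C_mul, pderiv_C, sub_zero, map_mul, constantCoeff_C,
        pderiv_X]
      change ∑ j, M⁻¹ i j * M j k - _ = 0
      rw [this]
      by_cases hik : i = k
      · subst hik; simp
      · simp [hik, Pi.single_apply, Matrix.one_apply, eq_comm]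
  have h1 : aeval l' p = 0 := by
    apply op_inj_unipotent g hg
    rw [← hfl, hll, hp]
  rw [← hll p, h1, map_zero]

/-- The Jacobian determinant is compatible with base change. -/
lemma op_jac_map {R A : Type*} [CommRing R] [CommRing A] (π : R →+* A) {n : ℕ}
    (f : Fin n → MvPolynomial (Fin n) R) (u : R)
    (hjac : Matrix.det (Matrix.of fun i j : Fin n => pderiv j (f i)) = C u) :
    Matrix.det (Matrix.of fun i j : Fin n => pderiv j (MvPolynomial.map π (f i))) = C (π u) := by
  have := congrArg (MvPolynomial.map π) hjac
  rw [RingHom.map_det, map_C] at this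
  rw [← this]
  congr 1
  ext1 i j
  simp [pderiv_map]

/-- Overring principle (instance used): let `f_1,…,f_n ∈ K[t][x_1,…,x_n]`. If the
`K(t)`-algebra endomorphism of `K(t)[x_1,…,x_n]` sending `x_i ↦ f_i` is an automorphism,
and the determinant of the Jacobian matrix `(∂f_i/∂x_j)` is a nonzero constant of `K`,
then the `K[t]`-algebra endomorphism of `K[t][x_1,…,x_n]` sending `x_i ↦ f_i` is an
automorphism. -/
theorem overring_principle (K : Type*) [Field K] (n : ℕ)
    (f : Fin n → MvPolynomial (Fin n) (Polynomial K))
    (hbij : Function.Bijective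
      (aeval (fun i => MvPolynomial.map (algebraMap (Polynomial K) (RatFunc K)) (f i)) :
        MvPolynomial (Fin n) (RatFunc K) →ₐ[RatFunc K] MvPolynomial (Fin n) (RatFunc K)))
    (c : K) (hc : c ≠ 0)
    (hjac : Matrix.det (Matrix.of fun i j : Fin n => pderiv j (f i))
      = C (Polynomial.C c)) :
    Function.Bijective
      (aeval f : MvPolynomial (Fin n) (Polynomial K) →ₐ[Polynomial K]
        MvPolynomial (Fin n) (Polynomial K)) := by
  have hcu : IsUnit (Polynomial.C c) := Polynomial.isUnit_C.mpr hc.isUnit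
  have hinj : Function.Injective
      (aeval f : MvPolynomial (Fin n) (Polynomial K) →ₐ[Polynomial K]
        MvPolynomial (Fin n) (Polynomial K)) :=
    (injective_iff_map_eq_zero _).mpr fun p hp => op_inj f _ hcu hjac p hp
  refine ⟨hinj, fun h => ?_⟩
  set ι := algebraMap (Polynomial K) (RatFunc K) with hι
  have hιinj : Function.Injective ι := IsFractionRing.injective _ _
  have hcomm : ∀ q : MvPolynomial (Fin n) (Polynomial K),
      MvPolynomial.map ι (aeval f q) =
        aeval (fun i => MvPolynomial.map ι (f i)) (MvPolynomial.map ι q) := by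
    intro q
    induction q using MvPolynomial.induction_on with
    | C a => simp [algHom_C]
    | add p q hp hq => rw [map_add, map_add, hp, hq, map_add, map_add]
    | mul_X p i hp => rw [map_mul, map_mul, hp, map_mul, map_mul, aeval_X, map_X, aeval_X]
  obtain ⟨P, hP⟩ := hbij.2 (MvPolynomial.map ι h)
  let _ : Algebra (MvPolynomial (Fin n) (Polynomial K)) (MvPolynomial (Fin n) (RatFunc K)) :=
    algebraMvPolynomial
  obtain ⟨⟨Q, s⟩, hQ⟩ := IsLocalization.surj
    ((nonZeroDivisors (Polynomial K)).map (C (σ := Fin n))) P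
  obtain ⟨_, a, ha, rfl⟩ := s
  have ha0 : a ≠ 0 := nonZeroDivisors.ne_zero ha
  replace hQ : P * MvPolynomial.map ι (C a) = MvPolynomial.map ι Q := hQ
  have hfQ : aeval f Q = h * C a := by
    apply MvPolynomial.map_injective ι hιinj
    rw [hcomm, ← hQ, map_mul, hP, map_mul]
    simp [algHom_C]
  let π := Ideal.Quotient.mk (Ideal.span {a})
  have hπ : ∀ r, π r = 0 ↔ a ∣ r := fun r => by
    rw [Ideal.Quotient.eq_zero_iff_mem, Ideal.mem_span_singleton]
  have hπcomm : ∀ q : MvPolynomial (Fin n) (Polynomial K),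
      MvPolynomial.map π (aeval f q) =
        aeval (fun i => MvPolynomial.map π (f i)) (MvPolynomial.map π q) := by
    intro q
    induction q using MvPolynomial.induction_on with
    | C a => simp [algHom_C]
    | add p q hp hq => rw [map_add, map_add, hp, hq, map_add, map_add]
    | mul_X p i hp => rw [map_mul, map_mul, hp, map_mul, map_mul, aeval_X, map_X, aeval_X]
  have hQ0 : MvPolynomial.map π Q = 0 := by
    apply op_inj (fun i => MvPolynomial.map π (f i)) (π (Polynomial.C c)) (hcu.map π)
    · exact op_jac_map π f _ hjac
    · rw [← hπcomm, hfQ, map_mul, map_C, (hπ a).mpr dvd_rfl]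
      simp
  obtain ⟨Q', rfl⟩ := (C_dvd_iff_map_hom_eq_zero π a hπ Q).mpr hQ0
  refine ⟨Q', ?_⟩
  have hCa : (C a : MvPolynomial (Fin n) (Polynomial K)) ≠ 0 := by simpa using ha0
  apply mul_right_cancel₀ hCa
  rw [← hfQ, map_mul, algHom_C, algebraMap_eq, mul_comm]
end

section
/- (Theorem 3.2, Bodnarchuk) Let K be an algebraically closed field of characteristic zero and n ≥ 3. For every triangular automorphism β of K[x_1,…,x_n] that is not affine, the subgroup of the automorphism group of K[x_1,…,x_n] generated by the affine subgroup A together with β equals the tame subgroup T. -/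
open MvPolynomial

namespace Bodn

variable {K : Type*} [Field K] {n : ℕ}

/-- `e` is the elementary automorphism `x_i ↦ x_i + f`. -/
def IsEl (i : Fin (n + 3)) (f : (MvPolynomial (Fin (n + 3)) K)) (e : (MvPolynomial (Fin (n + 3)) K ≃ₐ[K] MvPolynomial (Fin (n + 3)) K)) : Prop :=
  e (X i) = X i + f ∧ ∀ j, j ≠ i → e (X j) = X j

lemma agree (s : Set (Fin (n + 3))) (a b : (MvPolynomial (Fin (n + 3)) K) →ₐ[K] (MvPolynomial (Fin (n + 3)) K)) (h : ∀ j ∈ s, a (X j) = b (X j))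
    {f : (MvPolynomial (Fin (n + 3)) K)} (hf : f ∈ supported K s) : a f = b f := by
  have : supported K s ≤ AlgHom.equalizer a b := by
    unfold supported
    apply Algebra.adjoin_le
    rintro _ ⟨j, hj, rfl⟩
    exact h j hj
  exact this hf

lemma maps_supp (s t : Set (Fin (n + 3))) (a : (MvPolynomial (Fin (n + 3)) K) →ₐ[K] (MvPolynomial (Fin (n + 3)) K)) (h : ∀ j ∈ s, a (X j) ∈ supported K t)
    {f : (MvPolynomial (Fin (n + 3)) K)} (hf : f ∈ supported K s) : a f ∈ supported K t := by
  have : supported K s ≤ (supported K t).comap a := by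
    conv_lhs => unfold supported
    apply Algebra.adjoin_le
    rintro _ ⟨j, hj, rfl⟩
    exact h j hj
  exact this hf

lemma aut_ext {a b : (MvPolynomial (Fin (n + 3)) K ≃ₐ[K] MvPolynomial (Fin (n + 3)) K)} (h : ∀ j, a (X j) = b (X j)) : a = b := by
  have : (a : (MvPolynomial (Fin (n + 3)) K) →ₐ[K] (MvPolynomial (Fin (n + 3)) K)) = (b : (MvPolynomial (Fin (n + 3)) K) →ₐ[K] (MvPolynomial (Fin (n + 3)) K)) := MvPolynomial.algHom_ext (fun j => h j)
  ext1 x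
  exact DFunLike.congr_fun this x

lemma IsEl.fix {i : Fin (n + 3)} {f : (MvPolynomial (Fin (n + 3)) K)} {e : (MvPolynomial (Fin (n + 3)) K ≃ₐ[K] MvPolynomial (Fin (n + 3)) K)} (h : IsEl i f e) {g : (MvPolynomial (Fin (n + 3)) K)}
    (hg : g ∈ supported K ({i}ᶜ : Set (Fin (n + 3)))) : e g = g :=
  agree _ (e : (MvPolynomial (Fin (n + 3)) K) →ₐ[K] (MvPolynomial (Fin (n + 3)) K)) (AlgHom.id K (MvPolynomial (Fin (n + 3)) K)) (fun j hj => h.2 j hj) hg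

lemma exists_el (i : Fin (n + 3)) {f : (MvPolynomial (Fin (n + 3)) K)}
    (hf : f ∈ supported K ({i}ᶜ : Set (Fin (n + 3)))) : ∃ e : (MvPolynomial (Fin (n + 3)) K ≃ₐ[K] MvPolynomial (Fin (n + 3)) K), IsEl i f e := by
  let a : (MvPolynomial (Fin (n + 3)) K) → ((MvPolynomial (Fin (n + 3)) K) →ₐ[K] (MvPolynomial (Fin (n + 3)) K)) := fun g => aeval (fun j => if j = i then X i + g else X j)
  have hfix : ∀ g, a g f = f := fun g =>
    agree _ (a g) (AlgHom.id K (MvPolynomial (Fin (n + 3)) K)) (fun j hj => by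
      have : j ≠ i := hj
      simp [a, this]) hf
  refine ⟨AlgEquiv.ofAlgHom (a f) (a (-f)) ?_ ?_, ?_, ?_⟩
  · apply MvPolynomial.algHom_ext
    intro j
    by_cases hj : j = i
    · subst hj
      have h1 : a (-f) (X j) = X j + -f := by simp [a]
      have h2 : a f (X j) = X j + f := by simp [a]
      simp [h1, h2, hfix]
    · simp [a, hj]
  · apply MvPolynomial.algHom_ext
    intro j
    by_cases hj : j = i
    · subst hj
      have h1 : a (-f) (X j) = X j + -f := by simp [a]
      have h2 : a f (X j) = X j + f := by simp [a]
      simp [h1, h2, hfix]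
    · simp [a, hj]
  · simp [a]
  · intro j hj
    simp [a, hj]

lemma X_mem {i j : Fin (n + 3)} (h : j ≠ i) :
    (X j : (MvPolynomial (Fin (n + 3)) K)) ∈ supported K ({i}ᶜ : Set (Fin (n + 3))) :=
  MvPolynomial.X_mem_supported.2 h

lemma C_mem (s : Set (Fin (n + 3))) (c : K) : (C c : (MvPolynomial (Fin (n + 3)) K)) ∈ supported K s :=
  (supported K s).algebraMap_mem c

lemma exists_diag (t : Fin (n + 3) → K) (ht : ∀ i, t i ≠ 0) :
    ∃ e : (MvPolynomial (Fin (n + 3)) K ≃ₐ[K] MvPolynomial (Fin (n + 3)) K), ∀ i, e (X i) = C (t i) * X i := by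
  refine ⟨AlgEquiv.ofAlgHom (aeval fun i => C (t i) * X i) (aeval fun i => C (t i)⁻¹ * X i) ?_ ?_,
    fun i => by simp⟩
  · apply MvPolynomial.algHom_ext
    intro j
    simp only [AlgHom.comp_apply, aeval_X, map_mul, algHom_C, algebraMap_eq, AlgHom.id_apply]
    rw [← mul_assoc, ← C_mul, inv_mul_cancel₀ (ht j), C_1, one_mul]
  · apply MvPolynomial.algHom_ext
    intro j
    simp only [AlgHom.comp_apply, aeval_X, map_mul, algHom_C, algebraMap_eq, AlgHom.id_apply]
    rw [← mul_assoc, ← C_mul, mul_inv_cancel₀ (ht j), C_1, one_mul]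

lemma diag_affine {t : Fin (n + 3) → K} {e : (MvPolynomial (Fin (n + 3)) K ≃ₐ[K] MvPolynomial (Fin (n + 3)) K)} (h : ∀ i, e (X i) = C (t i) * X i) :
    IsAffineAut e := by
  intro i
  rw [h]
  refine (totalDegree_mul _ _).trans ?_
  simp

/-- The set of `f` such that `x_0 ↦ x_0 + f` lies in `G`. -/
def PS (G : Subgroup (MvPolynomial (Fin (n + 3)) K ≃ₐ[K] MvPolynomial (Fin (n + 3)) K)) : Set (MvPolynomial (Fin (n + 3)) K) :=
  {f | f ∈ supported K ({0}ᶜ : Set (Fin (n + 3))) ∧ ∃ e ∈ G, IsEl 0 f e}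

variable {G : Subgroup (MvPolynomial (Fin (n + 3)) K ≃ₐ[K] MvPolynomial (Fin (n + 3)) K)}

lemma conj_mem {f : (MvPolynomial (Fin (n + 3)) K)} (hf : f ∈ PS G) {ψ : (MvPolynomial (Fin (n + 3)) K ≃ₐ[K] MvPolynomial (Fin (n + 3)) K)} (hψ : ψ ∈ G) {α : K} (hα : α ≠ 0) {p : (MvPolynomial (Fin (n + 3)) K)}
    (hp : p ∈ supported K ({0}ᶜ : Set (Fin (n + 3))))
    (h0 : ψ (X 0) = C α * X 0 + p)
    (hj : ∀ j, j ≠ 0 → ψ (X j) ∈ supported K ({0}ᶜ : Set (Fin (n + 3)))) :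
    C α⁻¹ * ψ f ∈ PS G := by
  obtain ⟨hfS, e, heG, he⟩ := hf
  have hψf : ψ f ∈ supported K ({0}ᶜ : Set (Fin (n + 3))) :=
    maps_supp _ _ (ψ : (MvPolynomial (Fin (n + 3)) K) →ₐ[K] (MvPolynomial (Fin (n + 3)) K)) (fun j h => hj j h) hfS
  have hg : C α⁻¹ * ψ f ∈ supported K ({0}ᶜ : Set (Fin (n + 3))) :=
    mul_mem (C_mem _ _) hψf
  obtain ⟨e2, he2⟩ := exists_el 0 hg
  refine ⟨hg, e2, ?_, he2⟩
  have key : ψ * e = e2 * ψ := by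
    apply aut_ext
    intro j
    rw [AlgEquiv.mul_apply, AlgEquiv.mul_apply]
    by_cases h : j = 0
    · subst h
      have hC : e2 (C α) = C α := e2.commutes α
      rw [he.1, map_add, h0, map_add, map_mul, hC, he2.1, he2.fix hp, mul_add, ← mul_assoc,
        ← C_mul, mul_inv_cancel₀ hα, C_1, one_mul]
      ring
    · rw [he.2 j h, he2.fix (hj j h)]
  have : e2 = ψ * e * ψ⁻¹ := by rw [key]; group
  rw [this]
  exact G.mul_mem (G.mul_mem hψ heG) (G.inv_mem hψ)

lemma el_swap (hA : ∀ a : (MvPolynomial (Fin (n + 3)) K ≃ₐ[K] MvPolynomial (Fin (n + 3)) K), IsAffineAut a → a ∈ G) (i : Fin (n + 3)) {h : (MvPolynomial (Fin (n + 3)) K)} (hh : h ∈ PS G) :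
    ∃ e ∈ G, IsEl i (rename (Equiv.swap 0 i) h) e := by
  obtain ⟨-, e, heG, he⟩ := hh
  let ρ : (MvPolynomial (Fin (n + 3)) K ≃ₐ[K] MvPolynomial (Fin (n + 3)) K) := renameEquiv K (Equiv.swap 0 i)
  have hρX : ∀ j, ρ (X j) = X (Equiv.swap 0 i j) := fun j => by simp [ρ]
  have hρi : ∀ j, ρ⁻¹ (X j) = X (Equiv.swap 0 i j) := fun j => by
    have : ρ (X (Equiv.swap 0 i j)) = X j := by rw [hρX]; simp
    rw [← this]
    exact ρ.symm_apply_apply _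
  have hρ : ρ ∈ G := hA _ (fun j => by rw [hρX]; simp)
  refine ⟨ρ * e * ρ⁻¹, G.mul_mem (G.mul_mem hρ heG) (G.inv_mem hρ), ?_, ?_⟩
  · rw [AlgEquiv.mul_apply, AlgEquiv.mul_apply, hρi, Equiv.swap_apply_right, he.1, map_add, hρX,
      Equiv.swap_apply_left]
    simp [ρ]
  · intro j hj
    have : Equiv.swap 0 i j ≠ 0 := by
      intro h
      apply hj
      have := congrArg (Equiv.swap 0 i) h
      simpa using this
    rw [AlgEquiv.mul_apply, AlgEquiv.mul_apply, hρi, he.2 _ this, hρX]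
    simp

/-- `PS` as a submodule. -/
def PM (G : Subgroup (MvPolynomial (Fin (n + 3)) K ≃ₐ[K] MvPolynomial (Fin (n + 3)) K)) (hA : ∀ a : (MvPolynomial (Fin (n + 3)) K ≃ₐ[K] MvPolynomial (Fin (n + 3)) K), IsAffineAut a → a ∈ G) : Submodule K (MvPolynomial (Fin (n + 3)) K) where
  carrier := PS G
  add_mem' := by
    rintro f g ⟨hf, e, he, hef⟩ ⟨hg, e', he', heg⟩
    refine ⟨add_mem hf hg, e * e', G.mul_mem he he', ?_, ?_⟩
    · rw [AlgEquiv.mul_apply, heg.1, map_add, hef.1, hef.fix hg, add_assoc]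
    · intro j hj
      rw [AlgEquiv.mul_apply, heg.2 j hj, hef.2 j hj]
  zero_mem' := ⟨zero_mem _, 1, G.one_mem, by simp, by simp⟩
  smul_mem' := by
    intro c f hf
    by_cases hc : c = 0
    · subst hc
      rw [zero_smul]
      exact ⟨zero_mem _, 1, G.one_mem, by simp, by simp⟩
    · obtain ⟨e, he⟩ := exists_diag (K := K) (n := n) (fun i => if i = 0 then c⁻¹ else 1)
        (fun i => by split_ifs <;> simp [hc])
      have h1 := conj_mem hf (hA e (diag_affine he)) (inv_ne_zero hc) (zero_mem _)
        (by rw [he]; simp) (fun j hj => by rw [he]; exact mul_mem (C_mem _ _) (X_mem hj))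
      have h2 : e f = f := agree _ (e : (MvPolynomial (Fin (n + 3)) K) →ₐ[K] (MvPolynomial (Fin (n + 3)) K)) (AlgHom.id K (MvPolynomial (Fin (n + 3)) K)) (fun j hj => by
        have : j ≠ 0 := hj
        simp [he, this]) hf.1
      rw [h2, inv_inv] at h1
      rw [smul_eq_C_mul]
      exact h1

lemma mem_PM {hA : ∀ a : (MvPolynomial (Fin (n + 3)) K ≃ₐ[K] MvPolynomial (Fin (n + 3)) K), IsAffineAut a → a ∈ G} {f : (MvPolynomial (Fin (n + 3)) K)} : f ∈ PM G hA ↔ f ∈ PS G := Iff.rfl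

lemma torus [Infinite K] (hA : ∀ a : (MvPolynomial (Fin (n + 3)) K ≃ₐ[K] MvPolynomial (Fin (n + 3)) K), IsAffineAut a → a ∈ G) {f : (MvPolynomial (Fin (n + 3)) K)} (hf : f ∈ PS G)
    {m : Fin (n + 3) →₀ ℕ} (hm : coeff m f ≠ 0) : monomial m (1 : K) ∈ PS G := by
  rw [← mem_PM (hA := hA)]
  by_contra hcon
  obtain ⟨φ, hφ2, hφ1⟩ := Submodule.exists_le_ker_of_notMem hcon
  let g : (MvPolynomial (Fin (n + 3)) K) := ∑ k ∈ f.support, monomial k (coeff k f * φ (monomial k 1))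
  have hg : coeff m g = coeff m f * φ (monomial m 1) := by
    simp only [g, coeff_sum, coeff_monomial]
    rw [Finset.sum_ite_eq']
    rw [if_pos (by simpa [mem_support_iff] using hm)]
  have hz : g * ∏ i, X i = 0 := by
    apply MvPolynomial.funext
    intro t
    rw [map_mul, map_prod, map_zero]
    simp only [eval_X]
    by_cases ht : ∀ i, t i ≠ 0
    · obtain ⟨e, he⟩ := exists_diag t ht
      have h1 := conj_mem hf (hA e (diag_affine he)) (ht 0) (zero_mem _)
        (by rw [he]; simp) (fun j hj => by rw [he]; exact mul_mem (C_mem _ _) (X_mem hj))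
      have h2 : e f ∈ PM G hA := by
        have := (PM G hA).smul_mem (t 0) (mem_PM.2 h1)
        rwa [smul_eq_C_mul, ← mul_assoc, ← C_mul, mul_inv_cancel₀ (ht 0), C_1, one_mul] at this
      have h3 : φ (e f) = 0 := hφ1 h2
      have h4 : e f = ∑ k ∈ f.support, (coeff k f * ∏ i, t i ^ k i) • monomial k (1 : K) := by
        conv_lhs => rw [f.as_sum]
        rw [map_sum]
        refine Finset.sum_congr rfl fun k _ => ?_
        rw [monomial_eq, monomial_eq, Finsupp.prod_fintype _ _ (by simp), map_mul, map_prod]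
        have hC : ∀ c, e (C c) = C c := e.commutes
        simp only [map_pow, he, mul_pow, Finset.prod_mul_distrib, hC, smul_eq_C_mul, C_mul, map_prod,
          C_1, one_mul, mul_assoc]
      have h5 : eval t g = 0 := by
        rw [← h3, h4]
        simp only [g, map_sum, map_smul, eval_monomial]
        refine Finset.sum_congr rfl fun k _ => ?_
        rw [Finsupp.prod_fintype _ _ (by simp), smul_eq_mul]
        ring
      rw [h5, zero_mul]
    · push Not at ht
      obtain ⟨i, hi⟩ := ht
      rw [Finset.prod_eq_zero (Finset.mem_univ i) hi, mul_zero]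
  rcases mul_eq_zero.1 hz with h | h
  · rw [h, coeff_zero] at hg
    exact mul_ne_zero hm hφ2 hg.symm
  · exact Finset.prod_ne_zero_iff.2 (fun i _ => X_ne_zero i) h

lemma monomial_mem_supp {m : Fin (n + 3) →₀ ℕ} {s : Set (Fin (n + 3))} (h : ∀ i ∉ s, m i = 0) :
    (monomial m (1 : K)) ∈ supported K s := by
  rw [mem_supported, ]
  intro j hj
  by_contra hjs
  have := (MvPolynomial.mem_vars j).1 hj
  obtain ⟨d, hd, hjd⟩ := this
  rw [mem_support_iff, coeff_monomial] at hd
  split_ifs at hd with hmd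
  · subst hmd
    exact (Finsupp.mem_support_iff.1 hjd) (h j hjs)
  · exact hd rfl

lemma supp_zero {m : Fin (n + 3) →₀ ℕ} {i : Fin (n + 3)}
    (h : monomial m (1 : K) ∈ supported K ({i}ᶜ : Set (Fin (n + 3)))) : m i = 0 := by
  by_contra hne
  rw [mem_supported] at h
  have : i ∈ (monomial m (1 : K)).vars := by
    rw [vars_monomial one_ne_zero]
    exact Finsupp.mem_support_iff.2 hne
  exact h this rfl

lemma step [CharZero K] (hA : ∀ a : (MvPolynomial (Fin (n + 3)) K ≃ₐ[K] MvPolynomial (Fin (n + 3)) K), IsAffineAut a → a ∈ G) {m u : Fin (n + 3) →₀ ℕ}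
    {i : Fin (n + 3)} (hi : i ≠ 0)
    (hm : monomial (m + Finsupp.single i 1) (1 : K) ∈ PS G)
    (hu : monomial u (1 : K) ∈ PS G) (hui : u i = 0) : monomial (m + u) (1 : K) ∈ PS G := by
  have hu0 : u 0 = 0 := supp_zero hu.1
  obtain ⟨e, heG, he⟩ := el_swap hA i hu
  have hfix : rename (Equiv.swap 0 i) (monomial u (1 : K)) = monomial u 1 := by
    refine agree ({0, i}ᶜ) (rename (Equiv.swap 0 i)) (AlgHom.id K (MvPolynomial (Fin (n + 3)) K)) ?_ (monomial_mem_supp ?_)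
    · intro j hj
      simp only [Set.mem_compl_iff, Set.mem_insert_iff, Set.mem_singleton_iff, not_or] at hj
      rw [rename_X, Equiv.swap_apply_of_ne_of_ne hj.1 hj.2]
      rfl
    · intro j hj
      simp only [Set.mem_compl_iff, Set.mem_insert_iff, Set.mem_singleton_iff, not_not] at hj
      rcases hj with rfl | rfl <;> assumption
  rw [hfix] at he
  have h1 := conj_mem hm heG one_ne_zero (zero_mem _) (by rw [he.2 0 hi.symm]; simp)
    (fun j hj => by
      by_cases h : j = i
      · subst h
        rw [he.1]
        exact add_mem (X_mem hj) hu.1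
      · rw [he.2 j h]
        exact X_mem hj)
  rw [inv_one, C_1, one_mul] at h1
  refine torus hA h1 ?_
  set k := m i with hk
  set m' := m.erase i with hm'
  have hmm : m = m' + Finsupp.single i k := (Finsupp.erase_add_single i m).symm
  have h2 : e (monomial (m + Finsupp.single i 1) 1) =
      ∑ r ∈ Finset.range (k + 1 + 1),
        monomial (m' + r • Finsupp.single i 1 + (k + 1 - r) • u) ((k + 1).choose r : K) := by
    have hx : monomial (m + Finsupp.single i 1) (1 : K) = monomial m' 1 * X i ^ (k + 1) := by
      rw [X_pow_eq_monomial, monomial_mul, one_mul, hmm, add_assoc, ← Finsupp.single_add]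
    rw [hx, map_mul, map_pow, he.1, he.fix, add_pow, Finset.mul_sum]
    · refine Finset.sum_congr rfl fun r _ => ?_
      rw [X, monomial_pow, monomial_pow, monomial_mul, one_pow, one_pow, one_mul,
        ← map_natCast (C : K →+* (MvPolynomial (Fin (n + 3)) K)), mul_comm (monomial _ _), mul_comm _ (C _), mul_assoc,
        monomial_mul, C_mul_monomial, mul_one, mul_one]
      congr 1
      abel
    · apply monomial_mem_supp
      intro j hj
      have : j = i := by simpa using hj
      subst this
      simp [m']
  rw [h2, coeff_sum, Finset.sum_eq_single k]
  · rw [coeff_monomial, if_pos]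
    · simp
      exact_mod_cast Nat.succ_ne_zero k
    · simp only [Nat.add_sub_cancel_left, one_smul]
      rw [hmm]
      simp
  · intro r _ hr
    rw [coeff_monomial, if_neg]
    intro h
    apply hr
    have := DFunLike.congr_fun h i
    simpa [m', hui] using this
  · intro h
    simp at h

lemma base (hA : ∀ a : (MvPolynomial (Fin (n + 3)) K ≃ₐ[K] MvPolynomial (Fin (n + 3)) K), IsAffineAut a → a ∈ G) {f : (MvPolynomial (Fin (n + 3)) K)}
    (hf : f ∈ supported K ({0}ᶜ : Set (Fin (n + 3)))) (hd : f.totalDegree ≤ 1) : f ∈ PS G := by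
  obtain ⟨e, he⟩ := exists_el 0 hf
  refine ⟨hf, e, hA e fun j => ?_, he⟩
  by_cases h : j = 0
  · subst h
    rw [he.1]
    refine (totalDegree_add _ _).trans (max_le (by simp) hd)
  · rw [he.2 j h]
    simp

lemma repl [CharZero K] (hA : ∀ a : (MvPolynomial (Fin (n + 3)) K ≃ₐ[K] MvPolynomial (Fin (n + 3)) K), IsAffineAut a → a ∈ G) {m : Fin (n + 3) →₀ ℕ}
    {i j : Fin (n + 3)} (hi : i ≠ 0) (hj : j ≠ 0)
    (hm : monomial (m + Finsupp.single i 1) (1 : K) ∈ PS G) :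
    monomial (m + Finsupp.single j 1) (1 : K) ∈ PS G := by
  by_cases h : j = i
  · rwa [h]
  · refine step hA hi hm (base hA (X_mem hj) (by simp)) ?_
    simp [h]

lemma drop [CharZero K] (hA : ∀ a : (MvPolynomial (Fin (n + 3)) K ≃ₐ[K] MvPolynomial (Fin (n + 3)) K), IsAffineAut a → a ∈ G) (m' : Fin (n + 3) →₀ ℕ) :
    ∀ m : Fin (n + 3) →₀ ℕ, monomial (m + m') (1 : K) ∈ PS G → monomial m (1 : K) ∈ PS G := by
  induction m' using Finsupp.induction_linear with
  | zero => intro m hm; simpa using hm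
  | add a b iha ihb =>
    intro m hm
    rw [← add_assoc] at hm
    exact iha _ (ihb _ hm)
  | single i k =>
    induction k with
    | zero => intro m hm; simpa using hm
    | succ k ih =>
      intro m hm
      apply ih
      have h0 := supp_zero hm.1
      have hi : i ≠ 0 := by
        rintro rfl
        simp at h0
      rw [Finsupp.single_add, ← add_assoc] at hm
      have hz : monomial (0 : Fin (n + 3) →₀ ℕ) (1 : K) ∈ PS G :=
        base hA (C_mem _ 1) (by simp)
      simpa using step hA hi hm hz (by simp)

lemma spread [CharZero K] (hA : ∀ a : (MvPolynomial (Fin (n + 3)) K ≃ₐ[K] MvPolynomial (Fin (n + 3)) K), IsAffineAut a → a ∈ G) (m : Fin (n + 3) →₀ ℕ)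
    (h0 : m 0 = 0) :
    ∀ m' : Fin (n + 3) →₀ ℕ, (∀ k, monomial (m' + Finsupp.single 1 k) (1 : K) ∈ PS G) →
      ∀ k, monomial (m' + m + Finsupp.single 1 k) (1 : K) ∈ PS G := by
  induction m using Finsupp.induction_linear with
  | zero => intro m' hm; simpa using hm
  | add a b iha ihb =>
    intro m' hm
    have h0' : a 0 = 0 ∧ b 0 = 0 := by simpa using h0
    rw [← add_assoc]
    exact ihb h0'.2 _ (iha h0'.1 _ hm)
  | single i r =>
    induction r with
    | zero => intro m hm; simpa using hm
    | succ r ih =>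
      intro m' hm k
      have hi : i ≠ 0 := by
        rintro rfl
        simp at h0
      have h1 := ih (by simp [hi]) m' hm (k + 1)
      rw [Finsupp.single_add, ← add_assoc] at h1
      have h2 := repl hA (by simp) hi h1
      convert h2 using 2
      rw [Finsupp.single_add]
      abel

lemma exists_single {m : Fin (n + 3) →₀ ℕ} (hm : m ≠ 0) :
    ∃ i m', m = m' + Finsupp.single i 1 := by
  obtain ⟨i, hi⟩ := Finsupp.ne_iff.1 hm
  refine ⟨i, m - Finsupp.single i 1, ?_⟩
  rw [tsub_add_cancel_of_le]
  rw [Finsupp.single_le_iff]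
  exact Nat.one_le_iff_ne_zero.2 hi

lemma two_ne : (2 : Fin (n + 3)) ≠ 0 := by
  rw [Ne, Fin.ext_iff, Fin.val_two]
  simp

lemma one_ne_two' : (1 : Fin (n + 3)) ≠ 2 := by
  rw [Ne, Fin.ext_iff, Fin.val_two]
  simp

lemma all_mem [CharZero K] (hA : ∀ a : (MvPolynomial (Fin (n + 3)) K ≃ₐ[K] MvPolynomial (Fin (n + 3)) K), IsAffineAut a → a ∈ G) {f : (MvPolynomial (Fin (n + 3)) K)} (hf : f ∈ PS G)
    (hd : 1 < f.totalDegree) {g : (MvPolynomial (Fin (n + 3)) K)} (hg : g ∈ supported K ({0}ᶜ : Set (Fin (n + 3)))) :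
    g ∈ PS G := by
  have h12 : monomial (Finsupp.single 1 1 + Finsupp.single 2 1 : Fin (n + 3) →₀ ℕ) (1 : K)
      ∈ PS G := by
    obtain ⟨m, hm, hmd⟩ : ∃ m ∈ f.support, 1 < m.degree := by
      by_contra hcon
      push Not at hcon
      exact absurd hd (not_lt.2 (Finset.sup_le fun m hm => by
        have := hcon m hm
        rwa [Finsupp.degree_eq_sum, ← Finsupp.sum_fintype m (fun _ x => x) (by simp)] at this))
    have hmM := torus hA hf (mem_support_iff.1 hm)
    obtain ⟨i, a, rfl⟩ : ∃ i m', m = m' + Finsupp.single i 1 := exists_single (by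
      rintro rfl
      simp at hmd)
    obtain ⟨j, b, rfl⟩ : ∃ j m', a = m' + Finsupp.single j 1 := exists_single (by
      rintro rfl
      simp at hmd)
    have h0 := supp_zero hmM.1
    have hi : i ≠ 0 := by
      rintro rfl
      simp at h0
    have hj : j ≠ 0 := by
      rintro rfl
      simp at h0
    have h1 : monomial (Finsupp.single j 1 + Finsupp.single i 1 : Fin (n + 3) →₀ ℕ) (1 : K)
        ∈ PS G := by
      apply drop hA b
      convert hmM using 2
      abel
    have h2 := repl hA hi (j := 2) two_ne h1
    rw [add_comm (Finsupp.single j 1)] at h2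
    have h3 := repl hA hj (j := 1) (by simp) h2
    rwa [add_comm (Finsupp.single 2 1)] at h3
  have hpow : ∀ k, monomial ((0 : Fin (n + 3) →₀ ℕ) + Finsupp.single 1 k) (1 : K) ∈ PS G := by
    intro k
    rw [zero_add]
    induction k with
    | zero => exact base hA (by simp) (by simp)
    | succ k ih =>
      have := step hA two_ne h12 ih (by simp [one_ne_two'])
      rwa [← Finsupp.single_add, Nat.add_comm 1 k] at this
  rw [g.as_sum, ← mem_PM (hA := hA)]
  refine Submodule.sum_mem _ fun m hm => ?_
  have hm0 : m 0 = 0 := by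
    by_contra hne
    rw [mem_supported] at hg
    have : (0 : Fin (n + 3)) ∈ g.vars :=
      (mem_vars 0).2 ⟨m, hm, Finsupp.mem_support_iff.2 hne⟩
    exact hg this rfl
  have h := spread hA m hm0 0 hpow 0
  rw [Finsupp.single_zero, add_zero, zero_add] at h
  have h2 := (PM G hA).smul_mem (coeff m g) (mem_PM.2 h)
  rwa [smul_monomial, smul_eq_mul, mul_one] at h2

lemma el_mem (hA : ∀ a : (MvPolynomial (Fin (n + 3)) K ≃ₐ[K] MvPolynomial (Fin (n + 3)) K), IsAffineAut a → a ∈ G)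
    (hall : ∀ g : (MvPolynomial (Fin (n + 3)) K), g ∈ supported K ({0}ᶜ : Set (Fin (n + 3))) → g ∈ PS G)
    (i : Fin (n + 3)) {f : (MvPolynomial (Fin (n + 3)) K)} (hf : f ∈ supported K ({i}ᶜ : Set (Fin (n + 3)))) :
    ∃ e ∈ G, IsEl i f e := by
  have h1 : rename (Equiv.swap 0 i) f ∈ supported K ({0}ᶜ : Set (Fin (n + 3))) := by
    refine maps_supp _ _ (rename (Equiv.swap 0 i)) (fun j hj => ?_) hf
    rw [rename_X]
    apply X_mem
    intro h
    apply hj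
    have := congrArg (Equiv.swap 0 i) h
    simpa using this
  have h2 := el_swap hA i (hall _ h1)
  rw [rename_rename] at h2
  have h3 : (Equiv.swap 0 i : Fin (n + 3) → Fin (n + 3)) ∘ (Equiv.swap 0 i) = id := by
    funext j
    simp
  rwa [h3, rename_id_apply] at h2

lemma supp_gt_le (i : Fin (n + 3)) :
    supported K {j : Fin (n + 3) | i < j} ≤ supported K ({i}ᶜ : Set (Fin (n + 3))) :=
  supported_mono fun _ hj => ne_of_gt hj

lemma tri_mem (hA : ∀ a : (MvPolynomial (Fin (n + 3)) K ≃ₐ[K] MvPolynomial (Fin (n + 3)) K), IsAffineAut a → a ∈ G)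
    (hall : ∀ g : (MvPolynomial (Fin (n + 3)) K), g ∈ supported K ({0}ᶜ : Set (Fin (n + 3))) → g ∈ PS G) (k : ℕ) :
    ∀ b : (MvPolynomial (Fin (n + 3)) K ≃ₐ[K] MvPolynomial (Fin (n + 3)) K), IsTriangularAut b →
      (∀ j : Fin (n + 3), k ≤ j.val → ∃ α : K, b (X j) = C α * X j) → b ∈ G := by
  induction k with
  | zero =>
    intro b _ h
    choose t ht using fun j => h j (Nat.zero_le _)
    exact hA b (diag_affine ht)
  | succ k ih =>
    intro b hb h
    by_cases hk : n + 3 ≤ k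
    · exact ih b hb fun j hj => absurd j.isLt (by omega)
    push Not at hk
    let i : Fin (n + 3) := ⟨k, hk⟩
    obtain ⟨α, p, hp, hbi⟩ := hb i
    have hα : (α : K) ≠ 0 := α.ne_zero
    have hq : C (-(α : K)⁻¹) * p ∈ supported K {j : Fin (n + 3) | i < j} :=
      mul_mem (C_mem _ _) hp
    obtain ⟨e, heG, he⟩ := el_mem hA hall i (supp_gt_le i hq)
    have hC : ∀ c, e (C c) = C c := e.commutes
    have hei : (e * b) (X i) = C (α : K) * X i := by
      rw [AlgEquiv.mul_apply, hbi, map_add, map_mul, hC, he.1, he.fix (supp_gt_le i hp), mul_add,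
        ← mul_assoc, ← C_mul, mul_neg, mul_inv_cancel₀ hα, C_neg, C_1]
      ring
    have hmem : e * b ∈ G := by
      apply ih
      · intro j
        obtain ⟨γ, p', hp', hbj⟩ := hb j
        by_cases hji : j = i
        · subst hji
          exact ⟨α, 0, zero_mem _, by rw [hei, add_zero]⟩
        · refine ⟨γ, e p', ?_, ?_⟩
          · refine maps_supp _ _ (e : (MvPolynomial (Fin (n + 3)) K) →ₐ[K] (MvPolynomial (Fin (n + 3)) K)) (fun l hl => ?_) hp'
            by_cases hli : l = i
            · subst hli
              change e (X i) ∈ _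
              rw [he.1]
              refine add_mem (X_mem_supported.2 hl) (supported_mono ?_ hq)
              intro x hx
              exact lt_trans (Set.mem_setOf.1 hl) (Set.mem_setOf.1 hx)
            · change e (X l) ∈ _
              rw [he.2 l hli]
              exact X_mem_supported.2 hl
          · rw [AlgEquiv.mul_apply, hbj, map_add, map_mul, hC, he.2 j hji]
      · intro j hj
        by_cases hji : j = i
        · exact ⟨α, by rw [hji, hei]⟩
        · have : k ≠ j.val := fun h => hji (Fin.ext h.symm)
          obtain ⟨γ, hγ⟩ := h j (by omega)
          exact ⟨γ, by rw [AlgEquiv.mul_apply, hγ, map_mul, hC, he.2 j hji]⟩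
    have : b = e⁻¹ * (e * b) := by group
    rw [this]
    exact G.mul_mem (G.inv_mem heG) hmem

lemma exists_nonaff (hA : ∀ a : (MvPolynomial (Fin (n + 3)) K ≃ₐ[K] MvPolynomial (Fin (n + 3)) K), IsAffineAut a → a ∈ G) {β : (MvPolynomial (Fin (n + 3)) K ≃ₐ[K] MvPolynomial (Fin (n + 3)) K)} (hβ : β ∈ G)
    (htri : IsTriangularAut β) (hna : ¬ IsAffineAut β) : ∃ f ∈ PS G, 1 < f.totalDegree := by
  obtain ⟨α, p, hp, h0⟩ := htri 0
  have hα : (α : K) ≠ 0 := α.ne_zero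
  have hpS := supp_gt_le 0 hp
  have hS : ∀ j, j ≠ 0 → β (X j) ∈ supported K ({0}ᶜ : Set (Fin (n + 3))) := by
    intro j hj
    obtain ⟨γ, p', hp', h⟩ := htri j
    rw [h]
    refine add_mem (mul_mem (C_mem _ _) (X_mem hj)) (supported_mono ?_ hp')
    intro x hx
    exact ne_of_gt (lt_of_le_of_lt (Fin.zero_le j) hx)
  by_cases hex : ∃ j, j ≠ 0 ∧ 1 < (β (X j)).totalDegree
  · obtain ⟨j, hj, hd⟩ := hex
    refine ⟨C (α : K)⁻¹ * β (X j), conj_mem (base hA (X_mem hj) (by simp)) hβ hα hpS h0 hS, ?_⟩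
    by_contra hcon
    have h1 : β (X j) = C (α : K) * (C (α : K)⁻¹ * β (X j)) := by
      rw [← mul_assoc, ← C_mul, mul_inv_cancel₀ hα, C_1, one_mul]
    have h2 := totalDegree_mul (C (α : K)) (C (α : K)⁻¹ * β (X j))
    rw [← h1, totalDegree_C] at h2
    omega
  · push Not at hex
    have hpd : 1 < p.totalDegree := by
      by_contra hcon
      apply hna
      intro j
      by_cases hj : j = 0
      · subst hj
        rw [h0]
        refine (totalDegree_add _ _).trans (max_le ((totalDegree_mul _ _).trans (by simp)) ?_)
        omega
      · exact hex j hj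
    have hq : C (-(α : K)⁻¹) * p ∈ supported K ({0}ᶜ : Set (Fin (n + 3))) :=
      mul_mem (C_mem _ _) hpS
    obtain ⟨e, he⟩ := exists_el 0 hq
    have hC : ∀ c, e (C c) = C c := e.commutes
    have haff : e * β ∈ G := by
      apply hA
      intro j
      rw [AlgEquiv.mul_apply]
      by_cases hj : j = 0
      · subst hj
        have : e (β (X 0)) = C (α : K) * X 0 := by
          rw [h0, map_add, map_mul, hC, he.1, he.fix hpS, mul_add,
            ← mul_assoc, ← C_mul, mul_neg, mul_inv_cancel₀ hα, C_neg, C_1]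
          ring
        rw [this]
        exact (totalDegree_mul _ _).trans (by simp)
      · rw [he.fix (hS j hj)]
        exact hex j hj
    have heG : e ∈ G := by
      have : e = (e * β) * β⁻¹ := by group
      rw [this]
      exact G.mul_mem haff (G.inv_mem hβ)
    refine ⟨_, ⟨hq, e, heG, he⟩, ?_⟩
    by_contra hcon
    have h1 : p = C (-(α : K)) * (C (-(α : K)⁻¹) * p) := by
      rw [← mul_assoc, ← C_mul, neg_mul_neg, mul_inv_cancel₀ hα, C_1, one_mul]
    have h2 := totalDegree_mul (C (-(α : K))) (C (-(α : K)⁻¹) * p)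
    rw [← h1, totalDegree_C] at h2
    omega

end Bodn

/-- Theorem 3.2 (Bodnarchuk): over an algebraically closed field of characteristic zero
and with `n ≥ 3` variables, for every triangular non-affine automorphism `β` the subgroup
generated by the affine subgroup together with `β` is the whole tame subgroup (the
subgroup generated by the affine and the triangular automorphisms). -/
theorem affine_and_triangular_generate_tame
    (K : Type*) [Field K] [IsAlgClosed K] [CharZero K] (n : ℕ)
    (β : MvPolynomial (Fin (n + 3)) K ≃ₐ[K] MvPolynomial (Fin (n + 3)) K)
    (htri : IsTriangularAut β) (hnotaff : ¬ IsAffineAut β) :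
    Subgroup.closure
        ({a : MvPolynomial (Fin (n + 3)) K ≃ₐ[K] MvPolynomial (Fin (n + 3)) K |
            IsAffineAut a} ∪ {β})
      = Subgroup.closure
        ({a : MvPolynomial (Fin (n + 3)) K ≃ₐ[K] MvPolynomial (Fin (n + 3)) K |
            IsAffineAut a} ∪
         {b : MvPolynomial (Fin (n + 3)) K ≃ₐ[K] MvPolynomial (Fin (n + 3)) K |
            IsTriangularAut b}) := by
  apply le_antisymm
  · apply Subgroup.closure_mono
    rintro x (hx | hx)
    · exact Or.inl hx
    · rw [Set.mem_singleton_iff.1 hx]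
      exact Or.inr htri
  · rw [Subgroup.closure_le]
    have hA : ∀ a : MvPolynomial (Fin (n + 3)) K ≃ₐ[K] MvPolynomial (Fin (n + 3)) K,
        IsAffineAut a → a ∈ Subgroup.closure
        ({a : MvPolynomial (Fin (n + 3)) K ≃ₐ[K] MvPolynomial (Fin (n + 3)) K |
            IsAffineAut a} ∪ {β}) := fun a ha => Subgroup.subset_closure (Or.inl ha)
    rintro b (hb | hb)
    · exact hA b hb
    · obtain ⟨f, hf, hd⟩ := Bodn.exists_nonaff hA
        (Subgroup.subset_closure (Or.inr (Set.mem_singleton β))) htri hnotaff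
      exact Bodn.tri_mem hA (fun g hg => Bodn.all_mem hA hf hd hg) (n + 3) b hb
        (fun j hj => absurd j.isLt (by omega))
end

section
/- (Jung–van der Kulk) Let K be an algebraically closed field and n = 2. Then every K-algebra automorphism of K[x_1,x_2] is tame: the tame subgroup T (generated by the affine subgroup and the triangular subgroup) equals the full automorphism group of K[x_1,x_2]. -/
open MvPolynomial

namespace JVK

/-- `Top w d P Q`: all monomials of `P` have weight at most `d`, and `Q` is the part of weight `d`. -/
def Top {σ K : Type*} [Field K] (w : σ → ℚ) (d : ℚ) (P Q : MvPolynomial σ K) : Prop :=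
  (∀ m, coeff m P ≠ 0 → Finsupp.weight w m ≤ d) ∧ weightedHomogeneousComponent w d P = Q

section weights

variable {σ τ K : Type*} [Field K] {w : σ → ℚ}

theorem Top.coeff {d : ℚ} {P Q : MvPolynomial σ K} (h : Top w d P Q) (m : σ →₀ ℕ) :
    coeff m Q = if Finsupp.weight w m = d then coeff m P else 0 := by
  rw [← h.2, coeff_weightedHomogeneousComponent]

theorem top_iff {d : ℚ} {P Q : MvPolynomial σ K} : Top w d P Q ↔
    IsWeightedHomogeneous w Q d ∧ ∀ m, MvPolynomial.coeff m (P - Q) ≠ 0 → Finsupp.weight w m < d := by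
  constructor
  · intro h
    refine ⟨h.2 ▸ weightedHomogeneousComponent_isWeightedHomogeneous _ _, ?_⟩
    intro m hm
    rw [coeff_sub, h.coeff] at hm
    split_ifs at hm with h1
    · simp at hm
    · exact lt_of_le_of_ne (h.1 m (by simpa using hm)) h1
  · rintro ⟨h1, h2⟩
    have h3 : ∀ m, MvPolynomial.coeff m P = MvPolynomial.coeff m Q + MvPolynomial.coeff m (P - Q) := by
      intro m; simp
    refine ⟨?_, ?_⟩
    · intro m hm
      by_cases h4 : MvPolynomial.coeff m (P - Q) = 0
      · rw [h3, h4, add_zero] at hm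
        exact (h1 hm).le
      · exact (h2 m h4).le
    · ext m
      rw [coeff_weightedHomogeneousComponent]
      split_ifs with h4
      · rw [h3]
        by_contra h5
        have := h2 m (by intro h6; rw [h6] at h5; simp at h5)
        linarith
      · by_contra h5
        exact h4 (h1 (Ne.symm h5))

theorem Top.mul {d e : ℚ} {P Q P' Q' : MvPolynomial σ K} (h : Top w d P Q) (h' : Top w e P' Q') :
    Top w (d + e) (P * P') (Q * Q') := by
  classical
  have k := top_iff.1 h
  have k' := top_iff.1 h'
  rw [top_iff]
  refine ⟨k.1.mul k'.1, ?_⟩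
  intro m hm
  have e1 : P * P' - Q * Q' = (P - Q) * P' + Q * (P' - Q') := by ring
  rw [e1, coeff_add] at hm
  have : MvPolynomial.coeff m ((P - Q) * P') ≠ 0 ∨ MvPolynomial.coeff m (Q * (P' - Q')) ≠ 0 := by
    by_contra hh
    push Not at hh
    rw [hh.1, hh.2] at hm
    simp at hm
  rcases this with h1 | h1
  · rw [coeff_mul] at h1
    obtain ⟨⟨x, y⟩, hx, hy⟩ := Finset.exists_ne_zero_of_sum_ne_zero h1
    have a1 := k.2 x (left_ne_zero_of_mul hy)
    have a2 := h'.1 y (right_ne_zero_of_mul hy)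
    rw [Finset.HasAntidiagonal.mem_antidiagonal] at hx
    simp only at hx
    rw [← hx, map_add]
    linarith
  · rw [coeff_mul] at h1
    obtain ⟨⟨x, y⟩, hx, hy⟩ := Finset.exists_ne_zero_of_sum_ne_zero h1
    have a1 := k.1 (left_ne_zero_of_mul hy)
    have a2 := k'.2 y (right_ne_zero_of_mul hy)
    rw [Finset.HasAntidiagonal.mem_antidiagonal] at hx
    simp only at hx
    rw [← hx, map_add]
    linarith

theorem top_C (c : K) : Top w 0 (C c) (C c) := by
  rw [top_iff]
  exact ⟨isWeightedHomogeneous_C _ _, by simp⟩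

theorem top_X (i : σ) : Top (K := K) w (w i) (X i) (X i) := by
  rw [top_iff]
  exact ⟨isWeightedHomogeneous_X _ _ _, by simp⟩

theorem Top.pow {d : ℚ} {P Q : MvPolynomial σ K} (h : Top w d P Q) (n : ℕ) :
    Top w (n * d) (P ^ n) (Q ^ n) := by
  induction n with
  | zero => simpa using top_C (w := w) (1 : K)
  | succ n ih =>
    rw [pow_succ, pow_succ]
    have := ih.mul h
    convert this using 1
    push_cast; ring

theorem Top.prod {ι : Type*} (s : Finset ι) {d : ι → ℚ} {P Q : ι → MvPolynomial σ K}
    (h : ∀ i ∈ s, Top w (d i) (P i) (Q i)) :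
    Top w (∑ i ∈ s, d i) (∏ i ∈ s, P i) (∏ i ∈ s, Q i) := by
  classical
  induction s using Finset.induction_on with
  | empty => simpa using top_C (w := w) (1 : K)
  | insert a s ha ih =>
    rw [Finset.sum_insert ha, Finset.prod_insert ha, Finset.prod_insert ha]
    exact (h a (by simp)).mul (ih fun i hi => h i (by simp [hi]))

theorem Top.add {d : ℚ} {P Q P' Q' : MvPolynomial σ K} (h : Top w d P Q) (h' : Top w d P' Q') :
    Top w d (P + P') (Q + Q') := by
  refine ⟨?_, by rw [map_add, h.2, h'.2]⟩
  intro m hm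
  by_cases h1 : MvPolynomial.coeff m P = 0
  · rw [coeff_add, h1, zero_add] at hm
    exact h'.1 m hm
  · exact h.1 m h1

theorem top_zero (d : ℚ) : Top w d (0 : MvPolynomial σ K) 0 := ⟨by simp, by simp⟩

theorem Top.sum {ι : Type*} (s : Finset ι) {d : ℚ} {P Q : ι → MvPolynomial σ K}
    (h : ∀ i ∈ s, Top w d (P i) (Q i)) :
    Top w d (∑ i ∈ s, P i) (∑ i ∈ s, Q i) := by
  classical
  induction s using Finset.induction_on with
  | empty => simpa using top_zero d
  | insert a s ha ih =>
    rw [Finset.sum_insert ha, Finset.sum_insert ha]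
    exact (h a (by simp)).add (ih fun i hi => h i (by simp [hi]))

theorem Top.lt {d e : ℚ} {P Q : MvPolynomial σ K} (h : Top w d P Q) (hd : d < e) :
    Top w e P 0 := by
  rw [top_iff]
  refine ⟨isWeightedHomogeneous_zero _ _ _, ?_⟩
  intro m hm
  rw [sub_zero] at hm
  exact lt_of_le_of_lt (h.1 m hm) hd

theorem weight_fin [Fintype σ] (m : σ →₀ ℕ) : Finsupp.weight w m = ∑ i, (m i : ℚ) * w i := by
  rw [Finsupp.weight_apply, Finsupp.sum_fintype _ _ (by simp)]
  simp

theorem Top.aeval [Fintype σ] {w' : τ → ℚ} {d : ℚ} {P Q : MvPolynomial σ K} (h : Top w d P Q)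
    {g g' : σ → MvPolynomial τ K} (hg : ∀ i, Top w' (w i) (g i) (g' i)) :
    Top w' d (aeval g P) (aeval g' Q) := by
  classical
  have e1 : MvPolynomial.aeval g' Q = ∑ m ∈ P.support, if Finsupp.weight w m = d then
      C (MvPolynomial.coeff m P) * ∏ i, g' i ^ m i else 0 := by
    rw [aeval_def, eval₂_eq']
    have hs : Q.support ⊆ P.support := by
      intro m hm
      rw [mem_support_iff, h.coeff] at hm
      rw [mem_support_iff]
      intro h0
      simp [h0] at hm
    rw [← Finset.sum_subset hs (f := fun m => if Finsupp.weight w m = d then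
      C (MvPolynomial.coeff m P) * ∏ i, g' i ^ m i else 0)]
    · apply Finset.sum_congr rfl
      intro m hm
      rw [mem_support_iff, h.coeff] at hm
      rw [h.coeff]
      split_ifs at hm ⊢ with h1
      · rfl
      · simp at hm
    · intro m _ hm
      rw [notMem_support_iff, h.coeff] at hm
      split_ifs at hm ⊢ with h1
      · simp [hm]
      · rfl
  rw [e1, aeval_def, eval₂_eq']
  apply Top.sum
  intro m hm
  have h1 : Top w' (Finsupp.weight w m) (C (MvPolynomial.coeff m P) * ∏ i, g i ^ m i)
      (C (MvPolynomial.coeff m P) * ∏ i, g' i ^ m i) := by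
    have := (top_C (w := w') (MvPolynomial.coeff m P)).mul
      (Top.prod Finset.univ (fun i _ => (hg i).pow (m i)))
    rwa [zero_add, ← weight_fin] at this
  split_ifs with h2
  · rwa [h2] at h1
  · exact h1.lt (lt_of_le_of_ne (h.1 m (mem_support_iff.1 hm)) h2)

end weights

section core

open Polynomial in
theorem core_sep {B : Type*} [CommRing B] [IsDomain B] {n m : ℕ} (hn : 2 ≤ n) (hm : 2 ≤ m)
    (hnB : (n : B) ≠ 0) (hmB : (m : B) ≠ 0) {c h : B} (hc : c ≠ 0) (hh : h ≠ 0) :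
    ∀ (N : ℕ) (U V : B[X]), U.natDegree + V.natDegree ≤ N →
      U ^ n - Polynomial.C c * V ^ m = Polynomial.C h → U.natDegree = 0 ∧ V.natDegree = 0 := by
  intro N
  induction N using Nat.strong_induction_on with
  | _ N ih =>
  intro U V hN hUV
  have keyUV : U.natDegree = 0 ↔ V.natDegree = 0 := by
    have e1 : U ^ n = Polynomial.C c * V ^ m + Polynomial.C h := by rw [← hUV]; ring
    have e2 := congrArg Polynomial.natDegree e1
    rw [Polynomial.natDegree_add_C, Polynomial.natDegree_C_mul hc, Polynomial.natDegree_pow,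
      Polynomial.natDegree_pow] at e2
    constructor
    · intro h0; rw [h0] at e2
      rcases Nat.mul_eq_zero.1 (e2.symm.trans (by simp)) with h1 | h1 <;> omega
    · intro h0; rw [h0] at e2
      rcases Nat.mul_eq_zero.1 (e2.trans (by simp)) with h1 | h1 <;> omega
  by_contra hcon
  have hU : U.natDegree ≠ 0 := fun h0 => hcon ⟨h0, keyUV.1 h0⟩
  have hV : V.natDegree ≠ 0 := fun h0 => hcon ⟨keyUV.2 h0, h0⟩
  have hU0 : U ≠ 0 := by rintro rfl; simp at hU
  have hV0 : V ≠ 0 := by rintro rfl; simp at hV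
  have hnX : (n : B[X]) ≠ 0 := by rw [← Polynomial.C_eq_natCast]; exact Polynomial.C_ne_zero.2 hnB
  have hmX : (m : B[X]) ≠ 0 := by rw [← Polynomial.C_eq_natCast]; exact Polynomial.C_ne_zero.2 hmB
  have hcX : (Polynomial.C c : B[X]) ≠ 0 := by simpa using hc
  have hhX : (Polynomial.C h : B[X]) ≠ 0 := by simpa using hh
  have hder := congrArg Polynomial.derivative hUV
  rw [Polynomial.derivative_sub, Polynomial.derivative_C_mul, Polynomial.derivative_C,
    Polynomial.derivative_pow, Polynomial.derivative_pow] at hder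
  simp only [Polynomial.C_eq_natCast] at hder
  obtain ⟨n', rfl⟩ : ∃ n', n = n' + 2 := ⟨n - 2, by omega⟩
  obtain ⟨m', rfl⟩ : ∃ m', m = m' + 2 := ⟨m - 2, by omega⟩
  have q1 : n' + 2 - 1 = n' + 1 := by omega
  have q2 : m' + 2 - 1 = m' + 1 := by omega
  rw [q1, q2] at hder
  have ha : ((n' + 2 : ℕ) : B[X]).natDegree = 0 := Polynomial.natDegree_natCast _
  have hb : ((m' + 2 : ℕ) : B[X]).natDegree = 0 := Polynomial.natDegree_natCast _
  generalize ((n' + 2 : ℕ) : B[X]) = a at *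
  generalize ((m' + 2 : ℕ) : B[X]) = b at *
  by_cases hU' : Polynomial.derivative U = 0
  · have hV' : Polynomial.derivative V = 0 := by
      rw [hU', mul_zero, zero_sub, neg_eq_zero] at hder
      simpa [hcX, hmX, hV0] using hder
    obtain ⟨p, hp⟩ := CharP.exists B
    rcases CharP.char_is_prime_or_zero B p with hpp | hp0
    · have eU := Polynomial.expand_contract p hU' hpp.ne_zero
      have eV := Polynomial.expand_contract p hV' hpp.ne_zero
      set U1 := Polynomial.contract p U
      set V1 := Polynomial.contract p V
      have dU := congrArg Polynomial.natDegree eU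
      have dV := congrArg Polynomial.natDegree eV
      rw [Polynomial.natDegree_expand] at dU dV
      have h2 := hpp.two_le
      have hU1 : U1.natDegree ≠ 0 := by intro h0; rw [h0] at dU; simp at dU; omega
      have i1 : U1.natDegree * 2 ≤ U.natDegree := dU ▸ Nat.mul_le_mul_left _ h2
      have i2 : V1.natDegree * 2 ≤ V.natDegree := dV ▸ Nat.mul_le_mul_left _ h2
      refine hU1 (ih (U1.natDegree + V1.natDegree) (by omega) U1 V1 le_rfl ?_).1
      apply Polynomial.expand_injective hpp.pos
      rw [map_sub, map_mul, map_pow, map_pow, eU, eV, Polynomial.expand_C, Polynomial.expand_C, hUV]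
    · subst hp0
      have := CharP.charP_to_charZero B
      exact hU (Polynomial.derivative_eq_zero.1 hU')
  · have hV' : Polynomial.derivative V ≠ 0 := by
      intro h0
      rw [h0, mul_zero, mul_zero, sub_zero] at hder
      simp [hnX, hU0, hU'] at hder
    have d1 : V ^ (m' + 1) ∣ a * (Polynomial.C h * Polynomial.derivative U) := by
      refine ⟨Polynomial.C c * b * Polynomial.derivative V * U
        - a * Polynomial.C c * V * Polynomial.derivative U, ?_⟩
      linear_combination (-a * Polynomial.derivative U) * hUV + U * hder
    have d2 : U ^ (n' + 1) ∣ b * (Polynomial.C h * Polynomial.derivative V) := by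
      refine ⟨b * U * Polynomial.derivative V - a * V * Polynomial.derivative U, ?_⟩
      linear_combination (-b * Polynomial.derivative V) * hUV + V * hder
    have l1 := Polynomial.natDegree_le_of_dvd d1 (by simp [hnX, hhX, hU'])
    have l2 := Polynomial.natDegree_le_of_dvd d2 (by simp [hmX, hhX, hV'])
    rw [Polynomial.natDegree_pow, Polynomial.natDegree_mul hnX (by simp [hhX, hU']),
      Polynomial.natDegree_C_mul hh, ha] at l1
    rw [Polynomial.natDegree_pow, Polynomial.natDegree_mul hmX (by simp [hhX, hV']),
      Polynomial.natDegree_C_mul hh, hb] at l2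
    have l3 := Polynomial.natDegree_derivative_lt hU
    have l4 := Polynomial.natDegree_derivative_lt hV
    rw [add_mul] at l1 l2
    have := Nat.zero_le (m' * V.natDegree)
    have := Nat.zero_le (n' * U.natDegree)
    omega


variable {K : Type*} [Field K]

theorem degreeOf_zero_of_dvd {σ : Type*} {i : σ} {P Q : MvPolynomial σ K} (h : P ∣ Q) (hQ : Q ≠ 0)
    (hd : degreeOf i Q = 0) : degreeOf i P = 0 := by
  obtain ⟨r, rfl⟩ := h
  rw [degreeOf_mul_eq (left_ne_zero_of_mul hQ) (right_ne_zero_of_mul hQ)] at hd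
  omega

theorem degreeOf_pow_zero {σ : Type*} {i : σ} {P : MvPolynomial σ K} {n : ℕ} (hn : n ≠ 0)
    (h : degreeOf i (P ^ n) = 0) : degreeOf i P = 0 := by
  by_cases hP : P = 0
  · simp [hP]
  · rw [degreeOf_pow_eq _ _ _ hP] at h
    rcases Nat.mul_eq_zero.1 h with h | h
    · exact absurd h hn
    · exact h

/-- The constancy of one of the members in an equation `U ^ n - c V ^ m = h`, with `h` free of
`X 0`, implies that of the other one. -/
theorem degreeOf_other {U V P : MvPolynomial (Fin 3) K} {n m : ℕ} (hn : n ≠ 0) {c : K}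
    (hP : degreeOf 0 P = 0) (h : U ^ n - C c * V ^ m = P) (hV : degreeOf 0 V = 0) :
    degreeOf 0 U = 0 := by
  apply degreeOf_pow_zero hn
  have e : U ^ n = P + C c * V ^ m := by rw [← h]; ring
  rw [e]
  have h1 := degreeOf_add_le 0 P (C c * V ^ m)
  have h2 := degreeOf_C_mul_le (V ^ m) 0 c
  have h3 := degreeOf_pow_le 0 V m
  rw [hV] at h3
  rw [hP] at h1
  simp at h3
  rw [h3] at h2
  simpa [Nat.le_zero.1 h2] using h1

theorem core_insep {U V P : MvPolynomial (Fin 3) K} {n m : ℕ} (hm : 2 ≤ m) (hn0 : (n : K) = 0)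
    (hm0 : (m : K) ≠ 0) {c : K} (hc : c ≠ 0) {j : Fin 3} (hj : j ≠ 0)
    (h : U ^ n - C c * V ^ m = P ^ n - C c * X j ^ m) : degreeOf 0 V = 0 := by
  have hd := congrArg (pderiv j) h
  have hnS : (n : MvPolynomial (Fin 3) K) = 0 := by
    rw [← map_natCast (C : K →+* MvPolynomial (Fin 3) K), hn0, map_zero]
  have hmS : (m : MvPolynomial (Fin 3) K) ≠ 0 := by
    rw [← map_natCast (C : K →+* MvPolynomial (Fin 3) K)]
    exact (map_ne_zero_iff C (C_injective _ _)).2 hm0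
  have hcS : (C c : MvPolynomial (Fin 3) K) ≠ 0 := by simpa using hc
  simp only [map_sub, pderiv_pow, pderiv_C_mul, hnS, pderiv_X_self, zero_mul, zero_sub, neg_inj,
    mul_one] at hd
  have hd2 : V ^ (m - 1) * pderiv j V = X j ^ (m - 1) := by
    have e : (C c * (m : MvPolynomial (Fin 3) K)) * (V ^ (m - 1) * pderiv j V) =
        (C c * (m : MvPolynomial (Fin 3) K)) * X j ^ (m - 1) := by
      linear_combination hd
    exact mul_left_cancel₀ (mul_ne_zero hcS hmS) e
  apply degreeOf_pow_zero (n := m - 1) (by omega)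
  apply degreeOf_zero_of_dvd ⟨_, hd2.symm⟩
  · simp
  · exact degreeOf_X_pow_of_ne _ hj.symm

theorem core {U V : MvPolynomial (Fin 3) K} {n m : ℕ} (hn : 2 ≤ n) (hm : 2 ≤ m)
    (hnm : Nat.Coprime n m) {c : K} (hc : c ≠ 0)
    (h : U ^ n - C c * V ^ m = X 1 ^ n - C c * X 2 ^ m) : degreeOf 0 U = 0 ∧ degreeOf 0 V = 0 := by
  have hR : degreeOf 0 (X 1 ^ n - C c * X 2 ^ m : MvPolynomial (Fin 3) K) = 0 := by
    have h1 := degreeOf_sub_le 0 (X 1 ^ n : MvPolynomial (Fin 3) K) (C c * X 2 ^ m)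
    have h2 := degreeOf_C_mul_le (X 2 ^ m : MvPolynomial (Fin 3) K) 0 c
    rw [degreeOf_X_pow_of_ne _ (by decide)] at h1 h2
    simpa [Nat.le_zero.1 h2] using h1
  have h' : V ^ m - C c⁻¹ * U ^ n = X 2 ^ m - C c⁻¹ * X 1 ^ n := by
    have : (C c⁻¹ : MvPolynomial (Fin 3) K) * C c = 1 := by rw [← C_mul, inv_mul_cancel₀ hc, C_1]
    linear_combination (- C c⁻¹) * h + (X 2 ^ m - V ^ m) * this
  have hR' : degreeOf 0 (X 2 ^ m - C c⁻¹ * X 1 ^ n : MvPolynomial (Fin 3) K) = 0 := by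
    have h1 := degreeOf_sub_le 0 (X 2 ^ m : MvPolynomial (Fin 3) K) (C c⁻¹ * X 1 ^ n)
    have h2 := degreeOf_C_mul_le (X 1 ^ n : MvPolynomial (Fin 3) K) 0 c⁻¹
    rw [degreeOf_X_pow_of_ne _ (by decide)] at h1 h2
    simpa [Nat.le_zero.1 h2] using h1
  by_cases hn0 : (n : K) = 0
  · have hm0 : (m : K) ≠ 0 := by
      intro hm0
      have := (Nat.isCoprime_iff_coprime.2 hnm).map (Int.castRingHom K)
      simp [hn0, hm0] at this
    have hV := core_insep hm hn0 hm0 hc (by decide) h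
    exact ⟨degreeOf_other (by omega) hR h hV, hV⟩
  by_cases hm0 : (m : K) = 0
  · have hU := core_insep hn hm0 hn0 (inv_ne_zero hc) (by decide) h'
    exact ⟨hU, degreeOf_other (by omega) hR' h' hU⟩
  have e := congrArg (finSuccEquiv K 2) h
  have x1 : (X 1 : MvPolynomial (Fin 3) K) = X (Fin.succ 0) := rfl
  have x2 : (X 2 : MvPolynomial (Fin 3) K) = X (Fin.succ 1) := rfl
  have xc : ∀ c : K, finSuccEquiv K 2 (C c) = Polynomial.C (C c) := by
    intro c; simp [finSuccEquiv_apply]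
  rw [x1, x2] at e
  simp only [map_sub, map_mul, map_pow, xc, finSuccEquiv_X_succ] at e
  simp only [← Polynomial.C_pow, ← Polynomial.C_mul, ← Polynomial.C_sub] at e
  have hnS : (n : MvPolynomial (Fin 2) K) ≠ 0 := by
    rw [← map_natCast (C : K →+* MvPolynomial (Fin 2) K)]
    exact (map_ne_zero_iff C (C_injective _ _)).2 hn0
  have hmS : (m : MvPolynomial (Fin 2) K) ≠ 0 := by
    rw [← map_natCast (C : K →+* MvPolynomial (Fin 2) K)]
    exact (map_ne_zero_iff C (C_injective _ _)).2 hm0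
  have hcS : (C c : MvPolynomial (Fin 2) K) ≠ 0 := by simpa using hc
  have hh : (X 0 ^ n - C c * X 1 ^ m : MvPolynomial (Fin 2) K) ≠ 0 := by
    intro h0
    have := congrArg (MvPolynomial.eval ![1, 0]) h0
    simp [show m ≠ 0 by omega] at this
  have := core_sep hn hm hnS hmS hcS hh _ _ _ le_rfl e
  rwa [natDegree_finSuccEquiv, natDegree_finSuccEquiv] at this

end core
end JVK

namespace JVK

section degeneration

variable {K : Type*} [Field K]

theorem fse_rename (F : MvPolynomial (Fin 2) K) :
    finSuccEquiv K 2 (rename Fin.succ F) = Polynomial.C F := by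
  induction F using MvPolynomial.induction_on with
  | C a => simp [finSuccEquiv_apply]
  | add p q hp hq => simp only [map_add, hp, hq]
  | mul_X p i hp => simp only [map_mul, hp, rename_X, finSuccEquiv_X_succ]

theorem fse_const {P : MvPolynomial (Fin 3) K} (h : degreeOf 0 P = 0) :
    P = rename Fin.succ ((finSuccEquiv K 2 P).coeff 0) := by
  apply (finSuccEquiv K 2).injective
  rw [fse_rename]
  apply Polynomial.eq_C_of_natDegree_eq_zero
  rw [natDegree_finSuccEquiv, h]

/-- evaluation at `X 0 = 0` -/
noncomputable def ev0 : MvPolynomial (Fin 3) K →ₐ[K] MvPolynomial (Fin 2) K :=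
  (aeval ![0, X 0, X 1])

theorem ev0_eq (P : MvPolynomial (Fin 3) K) : ev0 P = (finSuccEquiv K 2 P).coeff 0 := by
  induction P using MvPolynomial.induction_on with
  | C a => simp [finSuccEquiv_apply, ev0]
  | add p q hp hq => simp only [map_add, hp, hq, Polynomial.coeff_add]
  | mul_X p i hp =>
    rw [map_mul, map_mul, Polynomial.mul_coeff_zero, hp]
    congr 1
    fin_cases i
    · change ev0 (X 0) = (finSuccEquiv K 2 (X 0)).coeff 0
      rw [finSuccEquiv_X_zero]; simp [ev0]
    · change ev0 (X (Fin.succ 0)) = (finSuccEquiv K 2 (X (Fin.succ 0))).coeff 0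
      rw [finSuccEquiv_X_succ]; simp [ev0]
    · change ev0 (X (Fin.succ 1)) = (finSuccEquiv K 2 (X (Fin.succ 1))).coeff 0
      rw [finSuccEquiv_X_succ]; simp [ev0]

theorem ev0_rename (F : MvPolynomial (Fin 2) K) : ev0 (rename Fin.succ F) = F := by
  rw [ev0_eq, fse_rename, Polynomial.coeff_C_zero]

theorem coeff_ev0 (P : MvPolynomial (Fin 3) K) (s : Fin 2 →₀ ℕ) :
    coeff s (ev0 P) = coeff (s.cons 0) P := by
  rw [ev0_eq, finSuccEquiv_coeff_coeff]

theorem degreeOf_rename_succ (F : MvPolynomial (Fin 2) K) :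
    degreeOf 0 (rename Fin.succ F) = 0 := by
  rw [← natDegree_finSuccEquiv, fse_rename, Polynomial.natDegree_C]

theorem ev0_aeval {W : Fin 2 → MvPolynomial (Fin 3) K} (hW : ∀ k, ev0 (W k) = X k)
    (G : MvPolynomial (Fin 2) K) : ev0 (aeval W G) = G := by
  have : (ev0 (K := K)).comp (aeval W) = AlgHom.id K _ := by
    apply MvPolynomial.algHom_ext
    intro i
    simp [hW]
  exact congrArg (fun f => f G) this

theorem fixed_factor {W : Fin 2 → MvPolynomial (Fin 3) K} (hW : ∀ k, ev0 (W k) = X k)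
    {F G : MvPolynomial (Fin 2) K} (hF0 : F ≠ 0) (hF : aeval W F = rename Fin.succ F)
    (hG : G ∣ F) : aeval W G = rename Fin.succ G := by
  have h1 : aeval W G ∣ rename Fin.succ F := by
    rw [← hF]; exact map_dvd _ hG
  have h2 := degreeOf_zero_of_dvd h1
    (by rwa [Ne, map_eq_zero_iff _ (rename_injective _ (Fin.succ_injective _))])
    (degreeOf_rename_succ F)
  rw [fse_const h2, ← ev0_eq, ev0_aeval hW]

theorem degenerate (φ : MvPolynomial (Fin 2) K ≃ₐ[K] MvPolynomial (Fin 2) K) (w : Fin 2 → ℚ)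
    (D : ℚ) {F : MvPolynomial (Fin 2) K} (hF : Top w D (φ (X 1)) F) :
    ∃ W : Fin 2 → MvPolynomial (Fin 3) K, (∃ k, degreeOf 0 (W k) ≠ 0) ∧
      (∀ k, ev0 (W k) = X k) ∧ aeval W F = rename Fin.succ F := by
  classical
  let χ : MvPolynomial (Fin 2) K →ₐ[K] MvPolynomial (Fin 3) K :=
    aeval ![rename Fin.succ (φ (X 0)) + X 0, rename Fin.succ (φ (X 1))]
  let W0 : Fin 2 → MvPolynomial (Fin 3) K := fun k => χ (φ.symm (X k))
  have hσ : ∀ P, aeval W0 P = χ (φ.symm P) := by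
    intro P
    have : aeval W0 = χ.comp (φ.symm : MvPolynomial (Fin 2) K →ₐ[K] MvPolynomial (Fin 2) K) := by
      apply MvPolynomial.algHom_ext
      intro i
      simp [W0]
    exact congrArg (fun f => f P) this
  have hχ : ∀ P, ev0 (χ P) = φ P := by
    intro P
    have : (ev0 (K := K)).comp χ = (φ : MvPolynomial (Fin 2) K →ₐ[K] MvPolynomial (Fin 2) K) := by
      apply MvPolynomial.algHom_ext
      intro i
      fin_cases i
      · simp [χ, ev0_rename]
        simp [ev0]
      · simp [χ, ev0_rename]
    exact congrArg (fun f => f P) this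
  have hW0 : ∀ k, ev0 (W0 k) = X k := by
    intro k
    simp only [W0, hχ, AlgEquiv.apply_symm_apply]
  -- nontriviality
  have hne : ∃ k, ∃ m, coeff m (W0 k) ≠ 0 ∧ m 0 ≠ 0 := by
    by_contra hcon
    push Not at hcon
    have h1 : ∀ k, W0 k = rename Fin.succ (X k) := by
      intro k
      have : degreeOf 0 (W0 k) = 0 := by
        rw [degreeOf_eq_sup]
        apply Nat.le_zero.1
        apply Finset.sup_le
        intro m hm
        exact (hcon k m (mem_support_iff.1 hm)).le
      rw [fse_const this, ← ev0_eq, hW0]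
    have h2 := hσ (φ (X 0))
    have h3 : aeval W0 = rename (R := K) (Fin.succ : Fin 2 → Fin 3) := by
      apply MvPolynomial.algHom_ext
      intro i
      rw [aeval_X, h1]
    rw [h3, AlgEquiv.symm_apply_apply] at h2
    simp [χ] at h2
  -- choice of the slope
  let M : Finset (Fin 2 × (Fin 3 →₀ ℕ)) :=
    (Finset.univ ×ˢ ((W0 0).support ∪ (W0 1).support)).filter
      (fun q => coeff q.2 (W0 q.1) ≠ 0 ∧ q.2 0 ≠ 0)
  have hM : ∀ k m, (k, m) ∈ M ↔ coeff m (W0 k) ≠ 0 ∧ m 0 ≠ 0 := by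
    intro k m
    simp only [M, Finset.mem_filter, Finset.mem_product, Finset.mem_univ, true_and,
      Finset.mem_union, mem_support_iff, and_iff_right_iff_imp]
    rintro ⟨h1, -⟩
    fin_cases k
    · exact Or.inl h1
    · exact Or.inr h1
  have hMne : M.Nonempty := by
    obtain ⟨k, m, h⟩ := hne
    exact ⟨(k, m), (hM k m).2 h⟩
  obtain ⟨⟨k0, m0⟩, hk0, hmax⟩ := Finset.exists_max_image M
    (fun q => ((q.2 1 : ℚ) * w 0 + (q.2 2 : ℚ) * w 1 - w q.1) / (q.2 0 : ℚ)) hMne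
  rw [hM] at hk0
  simp only at hmax
  set t : ℚ := ((m0 1 : ℚ) * w 0 + (m0 2 : ℚ) * w 1 - w k0) / (m0 0 : ℚ) with ht
  let w' : Fin 3 → ℚ := ![-t, w 0, w 1]
  have hw' : ∀ m : Fin 3 →₀ ℕ, Finsupp.weight w' m = -t * m 0 + (m 1 * w 0 + m 2 * w 1) := by
    intro m
    rw [weight_fin, Fin.sum_univ_three]
    simp [w']
    ring
  have hcons : ∀ k (s : Fin 2 →₀ ℕ), coeff (s.cons 0) (W0 k) ≠ 0 →
      Finsupp.weight w' (s.cons 0) = w k := by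
    intro k s hs
    rw [← coeff_ev0, hW0, coeff_X] at hs
    have hs' : Finsupp.single k 1 = s := by
      by_contra h; simp [h] at hs
    rw [hw', ← hs']
    have e0 : (Finsupp.cons 0 (Finsupp.single k 1 : Fin 2 →₀ ℕ)) 0 = 0 := Finsupp.cons_zero _ _
    have e1 : (Finsupp.cons 0 (Finsupp.single k 1 : Fin 2 →₀ ℕ)) 1 =
      (Finsupp.single k 1 : Fin 2 →₀ ℕ) 0 := Finsupp.cons_succ 0 _ _
    have e2 : (Finsupp.cons 0 (Finsupp.single k 1 : Fin 2 →₀ ℕ)) 2 =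
      (Finsupp.single k 1 : Fin 2 →₀ ℕ) 1 := Finsupp.cons_succ 1 _ _
    rw [e0, e1, e2]
    fin_cases k <;> simp
  have hTop : ∀ k, Top w' (w k) (W0 k) (weightedHomogeneousComponent w' (w k) (W0 k)) := by
    intro k
    refine ⟨?_, rfl⟩
    intro m hm
    by_cases hm0 : m 0 = 0
    · have e : m = Finsupp.cons 0 m.tail := by rw [← hm0, Finsupp.cons_tail]
      rw [e] at hm ⊢
      exact (hcons k _ hm).le
    · have h1 := hmax (k, m) ((hM k m).2 ⟨hm, hm0⟩)
      simp only at h1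
      have h2 : (0 : ℚ) < m 0 := by exact_mod_cast Nat.pos_of_ne_zero hm0
      rw [div_le_iff₀ h2] at h1
      rw [hw']
      linarith
  refine ⟨fun k => weightedHomogeneousComponent w' (w k) (W0 k), ⟨k0, ?_⟩, ?_, ?_⟩
  · have h2 : (0 : ℚ) < m0 0 := by exact_mod_cast Nat.pos_of_ne_zero hk0.2
    have h1 : coeff m0 (weightedHomogeneousComponent w' (w k0) (W0 k0)) ≠ 0 := by
      rw [coeff_weightedHomogeneousComponent, if_pos]
      · exact hk0.1
      · rw [hw', ht]
        field_simp
        ring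
    have h3 := monomial_le_degreeOf 0 (mem_support_iff.2 h1)
    exact fun h0 => hk0.2 (Nat.le_zero.1 (h3.trans h0.le))
  · intro k
    ext s
    rw [coeff_ev0, coeff_weightedHomogeneousComponent, ← hW0 k, coeff_ev0]
    split_ifs with h
    · rfl
    · by_contra h0
      exact h (hcons k s (Ne.symm h0))
  · have t1 := hF.aeval hTop
    have t2 := hF.aeval (w' := w') (g := fun i => X (Fin.succ i)) (g' := fun i => X (Fin.succ i))
      (by
        intro i
        have := top_X (K := K) (w := w') (Fin.succ i)
        have e : w' (Fin.succ i) = w i := by fin_cases i <;> rfl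
        rwa [e] at this)
    have e1 : aeval W0 (φ (X 1)) = rename Fin.succ (φ (X 1)) := by
      rw [hσ, AlgEquiv.symm_apply_apply]
      simp [χ]
    have e2 : ∀ P : MvPolynomial (Fin 2) K,
        aeval (fun i => (X (Fin.succ i) : MvPolynomial (Fin 3) K)) P = rename Fin.succ P := by
      intro P
      have : aeval (fun i => (X (Fin.succ i) : MvPolynomial (Fin 3) K)) =
          rename (R := K) (Fin.succ : Fin 2 → Fin 3) := by
        apply MvPolynomial.algHom_ext
        intro i
        rw [aeval_X, rename_X]
      rw [this]
    rw [e2, e2, ← e1] at t2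
    exact t1.2.symm.trans t2.2

end degeneration
end JVK

namespace JVK

section factor

variable {K : Type*} [Field K]

theorem X_dvd_of_coeff {σ : Type*} {i : σ} {F : MvPolynomial σ K}
    (h : ∀ s, coeff s F ≠ 0 → s i ≠ 0) : X i ∣ F := by
  rw [F.as_sum]
  apply Finset.dvd_sum
  intro s hs
  rw [X_dvd_monomial]
  exact Or.inr (h s (mem_support_iff.1 hs))

theorem coeff_eq_zero_of_X_dvd {σ : Type*} {i : σ} {F : MvPolynomial σ K}
    (h : X i ∣ F) {s : σ →₀ ℕ} (hs : s i = 0) : coeff s F = 0 := by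
  classical
  obtain ⟨q, rfl⟩ := h
  rw [coeff_X_mul', if_neg]
  simpa using hs

theorem finsupp_fin2_ext {s t : Fin 2 →₀ ℕ} (h0 : s 0 = t 0) (h1 : s 1 = t 1) : s = t := by
  ext i
  fin_cases i
  · exact h0
  · exact h1

theorem exists_degreeOf {σ : Type*} {i : σ} {F : MvPolynomial σ K} (h : 0 < degreeOf i F) :
    ∃ s, coeff s F ≠ 0 ∧ s i = degreeOf i F := by
  by_contra hcon
  push Not at hcon
  have : degreeOf i F < degreeOf i F := by
    rw [degreeOf_lt_iff h]
    intro m hm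
    exact lt_of_le_of_ne (monomial_le_degreeOf i hm) (hcon m (mem_support_iff.1 hm))
  omega

theorem monomial_fin2 (s : Fin 2 →₀ ℕ) (r : K) :
    monomial s r = C r * (X 0 ^ s 0 * X 1 ^ s 1) := by
  rw [monomial_eq, Finsupp.prod_fintype _ _ (by simp), Fin.prod_univ_two]

theorem homogeneous_factor [IsAlgClosed K] {n m d : ℕ} (hn : 0 < n) (hm : 0 < m) (hd : 0 < d)
    (hnm : Nat.Coprime n m) {F : MvPolynomial (Fin 2) K}
    (hF : ∀ s, coeff s F ≠ 0 → s 0 * m + s 1 * n = n * m * d)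
    (h0 : coeff (Finsupp.single 0 (n * d)) F ≠ 0) (h1 : coeff (Finsupp.single 1 (m * d)) F ≠ 0) :
    ∃ c : K, c ≠ 0 ∧ (X 0 ^ n - C c * X 1 ^ m) ∣ F := by
  classical
  let P : Polynomial K := ∑ s ∈ F.support, Polynomial.monomial (s 0) (coeff s F)
  have hP : ∀ s, coeff s F ≠ 0 → P.coeff (s 0) = coeff s F := by
    intro s hs
    simp only [P, Polynomial.finsetSum_coeff, Polynomial.coeff_monomial]
    rw [Finset.sum_eq_single s]
    · simp
    · intro t ht hts
      rw [if_neg]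
      intro h
      apply hts
      have e1 := hF s hs
      have e2 := hF t (mem_support_iff.1 ht)
      apply finsupp_fin2_ext h
      rw [h] at e2
      have : t 1 * n = s 1 * n := by omega
      exact Nat.eq_of_mul_eq_mul_right hn this
    · intro h
      exact absurd (mem_support_iff.2 hs) h
  have p0 := hP _ h0
  have p1 := hP _ h1
  rw [Finsupp.single_eq_same] at p0
  rw [Finsupp.single_eq_of_ne (by decide)] at p1
  have hdeg : P.degree ≠ 0 := by
    intro h
    have := Polynomial.eq_C_of_degree_eq_zero h
    rw [this, Polynomial.coeff_C, if_neg (by positivity)] at p0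
    exact h0 p0.symm
  obtain ⟨r, hr⟩ := IsAlgClosed.exists_root P hdeg
  have hr0 : r ≠ 0 := by
    rintro rfl
    rw [Polynomial.IsRoot, ← Polynomial.coeff_zero_eq_eval_zero, p1] at hr
    exact h1 hr
  refine ⟨r ^ n, pow_ne_zero _ hr0, ?_⟩
  have key : (X 0 ^ n - C (r ^ n) * X 1 ^ m) ∣ F - C (P.eval r) * X 1 ^ (m * d) := by
    have e1 : F - C (P.eval r) * X 1 ^ (m * d) = ∑ s ∈ F.support,
        (monomial s (coeff s F) - C (coeff s F * r ^ s 0) * X 1 ^ (m * d)) := by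
      rw [Finset.sum_sub_distrib, ← F.as_sum, ← Finset.sum_mul, ← map_sum]
      simp only [P, Polynomial.eval_finsetSum, Polynomial.eval_monomial]
    rw [e1]
    apply Finset.dvd_sum
    intro s hs
    have hs' := hF s (mem_support_iff.1 hs)
    obtain ⟨k, hk⟩ : n ∣ s 0 := by
      apply hnm.dvd_of_dvd_mul_right
      rw [← Nat.dvd_add_left (Dvd.intro_left (s 1) rfl), hs', mul_assoc]
      exact Dvd.intro _ rfl
    have hk2 : m * k + s 1 = m * d := by
      rw [hk] at hs'
      apply Nat.eq_of_mul_eq_mul_left hn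
      linarith
    rw [monomial_fin2, hk, ← hk2]
    have e2 : (C (coeff s F) : MvPolynomial (Fin 2) K) * (X 0 ^ (n * k) * X 1 ^ s 1) -
        C (coeff s F * r ^ (n * k)) * X 1 ^ (m * k + s 1) =
        ((X 0 ^ n) ^ k - (C (r ^ n) * X 1 ^ m) ^ k) * (C (coeff s F) * X 1 ^ s 1) := by
      rw [C_mul, pow_mul r, C_pow (r ^ n), mul_pow, pow_add, pow_mul, pow_mul]
      ring
    rw [e2]
    exact (sub_dvd_pow_sub_pow _ _ k).mul_right _
  have hr' : P.eval r = 0 := hr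
  simpa [hr'] using key

theorem factor [IsAlgClosed K] (φ : MvPolynomial (Fin 2) K ≃ₐ[K] MvPolynomial (Fin 2) K)
    {a b : ℕ} (ha : 0 < a) (hb : 0 < b) (hfa : degreeOf 0 (φ (X 1)) = a)
    (hfb : degreeOf 1 (φ (X 1)) = b) :
    ∃ (F : MvPolynomial (Fin 2) K) (c : K), Top ![(b : ℚ), (a : ℚ)] (a * b) (φ (X 1)) F ∧
      ((∃ m, b = a * m ∧ (X 0 - C c * X 1 ^ m) ∣ F) ∨
        (∃ m, a = b * m ∧ (X 1 - C c * X 0 ^ m) ∣ F)) := by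
  classical
  set f := φ (X 1) with hf
  set w : Fin 2 → ℚ := ![(b : ℚ), (a : ℚ)] with hw
  have hww : ∀ s : Fin 2 →₀ ℕ, Finsupp.weight w s = ((s 0 * b + s 1 * a : ℕ) : ℚ) := by
    intro s
    rw [weight_fin, Fin.sum_univ_two]
    simp [hw]
  obtain ⟨sa, hsa, hsa'⟩ := exists_degreeOf (i := 0) (F := f) (by omega)
  obtain ⟨sb, hsb, hsb'⟩ := exists_degreeOf (i := 1) (F := f) (by omega)
  obtain ⟨s0, hs0, hmax⟩ := Finset.exists_max_image f.support
    (fun s => s 0 * b + s 1 * a) ⟨sa, mem_support_iff.2 hsa⟩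
  set D : ℕ := s0 0 * b + s0 1 * a with hD
  have hTop : Top w (D : ℚ) f (weightedHomogeneousComponent w (D : ℚ) f) := by
    refine ⟨?_, rfl⟩
    intro s hs
    rw [hww]
    exact_mod_cast hmax s (mem_support_iff.2 hs)
  set F := weightedHomogeneousComponent w (D : ℚ) f with hFdef
  have hFs : ∀ s, coeff s F ≠ 0 → s 0 * b + s 1 * a = D ∧ coeff s f ≠ 0 := by
    intro s hs
    rw [hTop.coeff, hww] at hs
    split_ifs at hs with h
    · exact ⟨by exact_mod_cast h, hs⟩
    · simp at hs
  have hFs' : ∀ s, s 0 * b + s 1 * a = D → coeff s f ≠ 0 → coeff s F ≠ 0 := by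
    intro s h1 h2
    rwa [hTop.coeff, hww, if_pos (by exact_mod_cast h1)]
  have hF0 : F ≠ 0 := by
    intro h0
    have := hFs' s0 rfl (mem_support_iff.1 hs0)
    simp [h0] at this
  obtain ⟨W, ⟨k, hk⟩, hW, hWF⟩ := degenerate φ w D hTop
  have hDle : D ≤ a * b := by
    by_contra hlt
    push Not at hlt
    have hX : ∀ i, X i ∣ F := by
      intro i
      apply X_dvd_of_coeff
      intro s hs h0
      obtain ⟨h1, h2⟩ := hFs s hs
      have h3 := monomial_le_degreeOf 0 (mem_support_iff.2 h2)
      have h4 := monomial_le_degreeOf 1 (mem_support_iff.2 h2)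
      rw [hfa] at h3
      rw [hfb] at h4
      fin_cases i
      · have h0' : s 0 = 0 := h0
        rw [h0'] at h1
        nlinarith
      · have h0' : s 1 = 0 := h0
        rw [h0'] at h1
        nlinarith
    have := fixed_factor hW hF0 hWF (hX k)
    rw [aeval_X] at this
    rw [this] at hk
    exact hk (degreeOf_rename_succ _)
  have ga := hmax sa (mem_support_iff.2 hsa)
  have gb := hmax sb (mem_support_iff.2 hsb)
  rw [hsa', hfa] at ga
  rw [hsb', hfb] at gb
  have hDeq : D = a * b := by
    apply le_antisymm hDle
    exact le_trans (Nat.le_add_right _ _) ga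
  have za : sa 1 = 0 := by
    have : sa 1 * a ≤ 0 := by omega
    rcases Nat.mul_eq_zero.1 (Nat.le_zero.1 this) with h | h <;> omega
  have zb : sb 0 = 0 := by
    have : sb 0 * b ≤ 0 := by rw [mul_comm b a] at gb; omega
    rcases Nat.mul_eq_zero.1 (Nat.le_zero.1 this) with h | h <;> omega
  have ea : sa = Finsupp.single 0 a := by
    apply finsupp_fin2_ext
    · simp [hsa', hfa]
    · simp [za]
  have eb : sb = Finsupp.single 1 b := by
    apply finsupp_fin2_ext
    · simp [zb]
    · simp [hsb', hfb]
  have ca : coeff (Finsupp.single 0 a) F ≠ 0 := by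
    apply hFs'
    · simp [hDeq]
    · rwa [← ea]
  have cb : coeff (Finsupp.single 1 b) F ≠ 0 := by
    apply hFs'
    · simp [hDeq, mul_comm]
    · rwa [← eb]
  obtain ⟨n, m, hnm, hna, hmb⟩ := Nat.exists_coprime a b
  set d := Nat.gcd a b with hd
  have hd0 : 0 < d := Nat.gcd_pos_of_pos_left _ ha
  have hn0 : 0 < n := Nat.pos_of_ne_zero (by rintro rfl; simp at hna; omega)
  have hm0 : 0 < m := Nat.pos_of_ne_zero (by rintro rfl; simp at hmb; omega)
  obtain ⟨c, hc, hdvd⟩ := homogeneous_factor hn0 hm0 hd0 hnm (F := F) (by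
      intro s hs
      have h1 := (hFs s hs).1
      rw [hDeq, hna, hmb] at h1
      apply Nat.eq_of_mul_eq_mul_right hd0
      linarith) (by rwa [← hna]) (by rwa [← hmb])
  have hTop' : Top w (a * b : ℚ) f F := by
    have : (D : ℚ) = a * b := by exact_mod_cast hDeq
    rwa [this] at hTop
  have h1 : n = 1 ∨ m = 1 := by
    by_contra hcon
    have hfix := fixed_factor hW hF0 hWF hdvd
    simp only [map_sub, map_mul, map_pow, aeval_X, rename_X, algHom_C] at hfix
    have := core (by omega) (by omega) hnm hc hfix
    apply hk
    fin_cases k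
    · exact this.1
    · exact this.2
  rcases h1 with rfl | rfl
  · refine ⟨F, c, hTop', Or.inl ⟨m, ?_, by simpa using hdvd⟩⟩
    rw [one_mul] at hna
    rw [hna]
    rw [mul_comm]; exact hmb
  · refine ⟨F, c⁻¹, hTop', Or.inr ⟨n, ?_, ?_⟩⟩
    · rw [one_mul] at hmb
      rw [hmb]
      rw [mul_comm]; exact hna
    · refine dvd_trans ⟨-C c, ?_⟩ hdvd
      have : (C c⁻¹ : MvPolynomial (Fin 2) K) * C c = 1 := by
        rw [← C_mul, inv_mul_cancel₀ hc, C_1]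
      linear_combination (-X 0 ^ n) * this

end factor
end JVK

namespace JVK

section tame

variable {K : Type*} [Field K]

/-- The tame subgroup. -/
noncomputable abbrev tame (K : Type*) [Field K] :
    Subgroup (MvPolynomial (Fin 2) K ≃ₐ[K] MvPolynomial (Fin 2) K) :=
  Subgroup.closure
      ({a : MvPolynomial (Fin 2) K ≃ₐ[K] MvPolynomial (Fin 2) K | IsAffineAut a} ∪
       {b : MvPolynomial (Fin 2) K ≃ₐ[K] MvPolynomial (Fin 2) K | IsTriangularAut b})

theorem aut_ext {φ ψ : MvPolynomial (Fin 2) K ≃ₐ[K] MvPolynomial (Fin 2) K}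
    (h0 : φ (X 0) = ψ (X 0)) (h1 : φ (X 1) = ψ (X 1)) : φ = ψ := by
  have : (φ : MvPolynomial (Fin 2) K →ₐ[K] MvPolynomial (Fin 2) K) = ψ := by
    apply MvPolynomial.algHom_ext
    intro i
    fin_cases i
    · exact h0
    · exact h1
  ext x
  exact congrArg (fun f => coeff _ (f x)) this

/-- The elementary automorphism `X i ↦ X i + c (X j) ^ m`. -/
noncomputable def elemAut (i j : Fin 2) (hij : i ≠ j) (c : K) (m : ℕ) :
    MvPolynomial (Fin 2) K ≃ₐ[K] MvPolynomial (Fin 2) K :=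
  AlgEquiv.ofAlgHom (aeval (Function.update X i (X i + C c * X j ^ m)))
    (aeval (Function.update X i (X i - C c * X j ^ m)))
    (by
      apply MvPolynomial.algHom_ext
      intro k
      by_cases hk : k = i
      · subst hk; simp [hij.symm]
      · simp [hk])
    (by
      apply MvPolynomial.algHom_ext
      intro k
      by_cases hk : k = i
      · subst hk; simp [hij.symm]
      · simp [hk])

theorem elemAut_apply (i j : Fin 2) (hij : i ≠ j) (c : K) (m : ℕ) (f : MvPolynomial (Fin 2) K) :
    elemAut i j hij c m f = aeval (Function.update X i (X i + C c * X j ^ m)) f := rfl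

theorem elemAut_self (i j : Fin 2) (hij : i ≠ j) (c : K) (m : ℕ) :
    elemAut i j hij c m (X i) = X i + C c * X j ^ m := by
  simp [elemAut_apply]

theorem elemAut_other (i j : Fin 2) (hij : i ≠ j) (c : K) (m : ℕ) :
    elemAut i j hij c m (X j) = X j := by
  simp [elemAut_apply, hij.symm]

/-- The swap of the two variables. -/
noncomputable def swapAut : MvPolynomial (Fin 2) K ≃ₐ[K] MvPolynomial (Fin 2) K :=
  renameEquiv K (Equiv.swap 0 1)

theorem swapAut_zero : swapAut (K := K) (X 0) = X 1 := by simp [swapAut]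

theorem swapAut_one : swapAut (K := K) (X 1) = X 0 := by simp [swapAut]

theorem swapAut_mem : swapAut ∈ tame K := by
  apply Subgroup.subset_closure
  left
  intro i
  fin_cases i
  · change (swapAut (X 0)).totalDegree ≤ 1
    rw [swapAut_zero, totalDegree_X]
  · change (swapAut (X 1)).totalDegree ≤ 1
    rw [swapAut_one, totalDegree_X]

theorem elemAut_mem01 (c : K) (m : ℕ) : elemAut 0 1 (by decide) c m ∈ tame K := by
  apply Subgroup.subset_closure
  right
  intro i
  fin_cases i
  · refine ⟨1, C c * X 1 ^ m, ?_, ?_⟩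
    · apply Subalgebra.mul_mem
      · exact Subalgebra.algebraMap_mem _ c
      · exact Subalgebra.pow_mem _ (X_mem_supported.2 (by simp)) _
    · change elemAut 0 1 _ c m (X 0) = _
      rw [elemAut_self]; simp
  · refine ⟨1, 0, Subalgebra.zero_mem _, ?_⟩
    change elemAut 0 1 _ c m (X 1) = _
    rw [elemAut_other]; simp

theorem elemAut_mem (i j : Fin 2) (hij : i ≠ j) (c : K) (m : ℕ) :
    elemAut i j hij c m ∈ tame K := by
  have h10 : elemAut 1 0 (by decide) c m = swapAut * elemAut 0 1 (by decide) c m * swapAut := by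
    apply aut_ext
    · simp only [AlgEquiv.mul_apply, elemAut_other, swapAut_zero, swapAut_one]
    · simp only [AlgEquiv.mul_apply, elemAut_self, swapAut_zero, swapAut_one, map_add, map_mul,
        map_pow]
      simp [swapAut]
  fin_cases i <;> fin_cases j
  · exact absurd rfl hij
  · exact elemAut_mem01 c m
  · change elemAut 1 0 (by decide) c m ∈ tame K
    rw [h10]
    exact mul_mem (mul_mem swapAut_mem (elemAut_mem01 c m)) swapAut_mem
  · exact absurd rfl hij

theorem reduce (i j : Fin 2) (hij : i ≠ j) {a b m : ℕ} (ha : 0 < a) (hb : 0 < b) {c : K}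
    (hm : b = a * m) {w : Fin 2 → ℚ} (hwi : w i = b) (hwj : w j = a) {f F : MvPolynomial (Fin 2) K}
    (hT : Top w (a * b) f F) (hd : (X i - C c * X j ^ m) ∣ F) :
    degreeOf i (elemAut i j hij c m f) ≤ a ∧ degreeOf j (elemAut i j hij c m f) < b := by
  have hww : ∀ s : Fin 2 →₀ ℕ, Finsupp.weight w s = ((s i * b + s j * a : ℕ) : ℚ) := by
    intro s
    rw [weight_fin, Fin.sum_univ_two]
    push_cast
    rw [← hwi, ← hwj]
    fin_cases i <;> fin_cases j
    · exact absurd rfl hij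
    · rfl
    · exact add_comm _ _
    · exact absurd rfl hij
  have hT2 : Top w (a * b) (elemAut i j hij c m f) (elemAut i j hij c m F) := by
    rw [elemAut_apply, elemAut_apply]
    apply hT.aeval
    intro k
    by_cases hk : k = i
    · subst hk
      simp only [Function.update_self]
      apply (top_X _).add
      have := (top_C (w := w) c).mul ((top_X (K := K) (w := w) j).pow m)
      rw [hwj] at this
      rw [hwi, hm]
      convert this using 1
      push_cast; ring
    · simp only [Function.update_of_ne hk]
      exact top_X _
  have hX : X i ∣ elemAut i j hij c m F := by
    have := map_dvd (elemAut i j hij c m) hd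
    rw [map_sub, map_mul, map_pow, elemAut_self, elemAut_other] at this
    have e : elemAut i j hij c m (C c) = C c := by simp [elemAut_apply]
    rwa [e, add_sub_cancel_right] at this
  have hle : ∀ s, coeff s (elemAut i j hij c m f) ≠ 0 → s i * b + s j * a ≤ a * b := by
    intro s hs
    have := hT2.1 s hs
    rw [hww] at this
    exact_mod_cast this
  constructor
  · rw [degreeOf_eq_sup]
    apply Finset.sup_le
    intro s hs
    have := hle s (mem_support_iff.1 hs)
    exact Nat.le_of_mul_le_mul_right (le_trans (Nat.le_add_right _ _) this) hb
  · rw [degreeOf_lt_iff hb]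
    intro s hs
    rw [mem_support_iff] at hs
    have h1 := hle s hs
    have h2 : s j ≤ b := by
      apply Nat.le_of_mul_le_mul_left _ ha
      rw [mul_comm a (s j)]
      exact le_trans (Nat.le_add_left _ _) h1
    apply lt_of_le_of_ne h2
    intro h3
    have h4 : s i = 0 := by
      rw [h3, mul_comm b a] at h1
      have : s i * b = 0 := by omega
      rcases Nat.mul_eq_zero.1 this with h | h <;> omega
    have h5 := coeff_eq_zero_of_X_dvd hX h4
    rw [hT2.coeff, if_pos] at h5
    · exact hs h5
    · rw [hww, h3, h4]
      push_cast; ring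

theorem fix_one (φ : MvPolynomial (Fin 2) K ≃ₐ[K] MvPolynomial (Fin 2) K)
    (h : φ (X 1) = X 1) : φ ∈ tame K := by
  have x1 : (X 1 : MvPolynomial (Fin 2) K) = X (Fin.succ 0) := rfl
  have xc : ∀ c : K, finSuccEquiv K 1 (C c) = Polynomial.C (C c) := by
    intro c; simp [finSuccEquiv_apply]
  have key : ∀ P, finSuccEquiv K 1 (φ P) =
      (finSuccEquiv K 1 P).comp (finSuccEquiv K 1 (φ (X 0))) := by
    intro P
    induction P using MvPolynomial.induction_on with
    | C a =>
      have : φ (C a) = C a := φ.commutes a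
      rw [this, xc, Polynomial.C_comp]
    | add p q hp hq => simp only [map_add, hp, hq, Polynomial.add_comp]
    | mul_X p i hp =>
      simp only [map_mul, hp, Polynomial.mul_comp]
      congr 1
      fin_cases i
      · change finSuccEquiv K 1 (φ (X 0)) =
          (finSuccEquiv K 1 (X 0)).comp (finSuccEquiv K 1 (φ (X 0)))
        rw [finSuccEquiv_X_zero, Polynomial.X_comp]
      · change finSuccEquiv K 1 (φ (X 1)) =
          (finSuccEquiv K 1 (X 1)).comp (finSuccEquiv K 1 (φ (X 0)))
        rw [h, x1, finSuccEquiv_X_succ, Polynomial.C_comp]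
  have k1 := key (φ.symm (X 0))
  rw [AlgEquiv.apply_symm_apply, finSuccEquiv_X_zero] at k1
  set g := finSuccEquiv K 1 (φ (X 0)) with hg
  set g' := finSuccEquiv K 1 (φ.symm (X 0)) with hg'
  have k2 := congrArg Polynomial.natDegree k1
  rw [Polynomial.natDegree_X, Polynomial.natDegree_comp] at k2
  have d1 : g.natDegree = 1 := Nat.eq_one_of_mul_eq_one_left k2.symm
  have d2 : g'.natDegree = 1 := Nat.eq_one_of_mul_eq_one_right k2.symm
  have e1 := Polynomial.eq_X_add_C_of_natDegree_le_one d1.le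
  have e2 := Polynomial.eq_X_add_C_of_natDegree_le_one d2.le
  set u := g.coeff 1
  set v := g.coeff 0
  set u' := g'.coeff 1
  set v' := g'.coeff 0
  have k3 := congrArg (fun p => Polynomial.coeff p 1) k1
  rw [e1, e2] at k3
  simp [Polynomial.coeff_C] at k3
  have hu : IsUnit u := IsUnit.of_mul_eq_one u' (by rw [mul_comm]; exact k3.symm)
  obtain ⟨α, hα, hα'⟩ := isUnit_iff_eq_C_of_isReduced.1 hu
  apply Subgroup.subset_closure
  right
  intro i
  fin_cases i
  · refine ⟨hα.unit, rename Fin.succ v, ?_, ?_⟩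
    · rw [mem_supported]
      intro j hj
      have := vars_rename (Fin.succ : Fin 1 → Fin 2) v
      have hj' := this hj
      rw [Finset.mem_image] at hj'
      obtain ⟨k, -, rfl⟩ := hj'
      exact Fin.succ_pos k
    · apply (finSuccEquiv K 1).injective
      change g = _
      have : ∀ F : MvPolynomial (Fin 1) K,
          finSuccEquiv K 1 (rename Fin.succ F) = Polynomial.C F := by
        intro F
        induction F using MvPolynomial.induction_on with
        | C a => simp [finSuccEquiv_apply]
        | add p q hp hq => simp only [map_add, hp, hq]
        | mul_X p i hp => simp only [map_mul, hp, rename_X, finSuccEquiv_X_succ]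
      rw [map_add, map_mul, this, xc]
      change g = Polynomial.C (C α) * finSuccEquiv K 1 (X 0) + _
      rw [finSuccEquiv_X_zero, ← hα', ← e1]
  · refine ⟨1, 0, Subalgebra.zero_mem _, ?_⟩
    change φ (X 1) = _
    rw [h]; simp

theorem base_zero [IsAlgClosed K] (φ : MvPolynomial (Fin 2) K ≃ₐ[K] MvPolynomial (Fin 2) K)
    (h : degreeOf 0 (φ (X 1)) = 0) : φ ∈ tame K := by
  let q : Polynomial K := aeval ![0, Polynomial.X] (φ (X 1))
  have hq : Polynomial.aeval (X 1 : MvPolynomial (Fin 2) K) q = φ (X 1) := by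
    have e1 : Polynomial.aeval (X 1 : MvPolynomial (Fin 2) K) q =
        aeval ![0, X 1] (φ (X 1)) := by
      have : (Polynomial.aeval (X 1 : MvPolynomial (Fin 2) K)).comp (aeval ![0, Polynomial.X]) =
          aeval (R := K) ![0, (X 1 : MvPolynomial (Fin 2) K)] := by
        apply MvPolynomial.algHom_ext
        intro i
        fin_cases i <;> simp
      exact congrArg (fun f => f (φ (X 1))) this
    rw [e1]
    conv_rhs => rw [(φ (X 1)).as_sum]
    rw [aeval_def, eval₂_eq']
    apply Finset.sum_congr rfl
    intro s hs
    have hs0 := monomial_le_degreeOf 0 hs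
    rw [h] at hs0
    rw [monomial_fin2, Fin.prod_univ_two, Nat.le_zero.1 hs0]
    simp
  have hirr : Irreducible (φ (X 1)) := by
    have : Prime (X 1 : MvPolynomial (Fin 2) K) := X_prime
    exact (MulEquiv.irreducible_iff φ.toMulEquiv).2 this.irreducible
  have hdeg : q.degree ≠ 0 := by
    intro h0
    rw [Polynomial.eq_C_of_degree_eq_zero h0, Polynomial.aeval_C] at hq
    have h1 := congrArg φ.symm hq
    rw [AlgEquiv.symm_apply_apply, AlgEquiv.commutes] at h1
    have := congrArg (degreeOf 1) h1
    rw [algebraMap_eq, degreeOf_C, degreeOf_X_self] at this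
    omega
  obtain ⟨r, hr⟩ := IsAlgClosed.exists_root q hdeg
  obtain ⟨q2, hq2⟩ := Polynomial.dvd_iff_isRoot.2 hr
  rw [hq2, map_mul, map_sub, Polynomial.aeval_X, Polynomial.aeval_C, algebraMap_eq] at hq
  have hnu : ¬ IsUnit (X 1 - C r : MvPolynomial (Fin 2) K) := by
    intro hu
    have := hu.map (MvPolynomial.eval ![0, r])
    simp at this
  have hu := (hirr.isUnit_or_isUnit hq.symm).resolve_left hnu
  obtain ⟨α, hα, hα'⟩ := isUnit_iff_eq_C_of_isReduced.1 hu
  rw [hα'] at hq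
  have hα0 : α ≠ 0 := hα.ne_zero
  have hmul : (C α : MvPolynomial (Fin 2) K) * C α⁻¹ = 1 := by
    rw [← C_mul, mul_inv_cancel₀ hα0, C_1]
  let ψ : MvPolynomial (Fin 2) K ≃ₐ[K] MvPolynomial (Fin 2) K :=
    AlgEquiv.ofAlgHom (aeval ![X 0, C α⁻¹ * X 1 + C r]) (aeval ![X 0, (X 1 - C r) * C α])
      (by
        apply MvPolynomial.algHom_ext
        intro i
        fin_cases i
        · simp
        · simp
          linear_combination (X 1) * hmul)
      (by
        apply MvPolynomial.algHom_ext
        intro i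
        fin_cases i
        · simp
        · simp
          linear_combination (X 1 - C r) * hmul)
  have hψ0 : ψ (X 0) = X 0 := by simp [ψ]
  have hψ1 : ψ (X 1) = C α⁻¹ * X 1 + C r := by simp [ψ]
  have hψ : ψ ∈ tame K := by
    apply Subgroup.subset_closure
    left
    intro i
    fin_cases i
    · change (ψ (X 0)).totalDegree ≤ 1
      rw [hψ0, totalDegree_X]
    · change (ψ (X 1)).totalDegree ≤ 1
      rw [hψ1]
      refine (totalDegree_add _ _).trans ?_
      have := totalDegree_mul (C α⁻¹ : MvPolynomial (Fin 2) K) (X 1)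
      simp only [totalDegree_C, totalDegree_X] at this ⊢
      omega
  rw [← Subgroup.mul_mem_cancel_left _ hψ]
  apply fix_one
  rw [AlgEquiv.mul_apply, ← hq, map_mul, map_sub, hψ1]
  have hC : ∀ c, ψ (C c) = C c := fun c => ψ.commutes c
  rw [hC, hC]
  linear_combination (X 1) * hmul

theorem main [IsAlgClosed K] (N : ℕ) :
    ∀ φ : MvPolynomial (Fin 2) K ≃ₐ[K] MvPolynomial (Fin 2) K,
      degreeOf 0 (φ (X 1)) + degreeOf 1 (φ (X 1)) ≤ N → φ ∈ tame K := by
  induction N using Nat.strong_induction_on with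
  | _ N ih =>
  intro φ hN
  by_cases h0 : degreeOf 0 (φ (X 1)) = 0
  · exact base_zero φ h0
  by_cases h1 : degreeOf 1 (φ (X 1)) = 0
  · rw [← Subgroup.mul_mem_cancel_left _ swapAut_mem]
    apply base_zero
    rw [AlgEquiv.mul_apply]
    have := degreeOf_rename_of_injective (p := φ (X 1)) (Equiv.swap (0 : Fin 2) 1).injective 1
    rw [Equiv.swap_apply_right] at this
    exact this.trans h1
  have ha := Nat.pos_of_ne_zero h0
  have hb := Nat.pos_of_ne_zero h1
  obtain ⟨F, c, hT, ⟨m, hm, hd⟩ | ⟨m, hm, hd⟩⟩ := factor φ ha hb rfl rfl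
  · have := reduce 0 1 (by decide) ha hb hm (by simp) (by simp) hT hd
    rw [← Subgroup.mul_mem_cancel_left _ (elemAut_mem 0 1 (by decide) c m)]
    refine ih _ ?_ _ le_rfl
    rw [AlgEquiv.mul_apply]
    omega
  · rw [mul_comm] at hT
    have := reduce 1 0 (by decide) hb ha hm (by simp) (by simp) hT hd
    rw [← Subgroup.mul_mem_cancel_left _ (elemAut_mem 1 0 (by decide) c m)]
    refine ih _ ?_ _ le_rfl
    rw [AlgEquiv.mul_apply]
    omega

end tame
end JVK

/-- Jung–van der Kulk: over an algebraically closed field `K`, every `K`-algebra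
automorphism of `K[x_1,x_2]` is tame, i.e. belongs to the subgroup generated by the
affine automorphisms and the triangular automorphisms. -/
theorem jung_van_der_kulk (K : Type*) [Field K] [IsAlgClosed K]
    (φ : MvPolynomial (Fin 2) K ≃ₐ[K] MvPolynomial (Fin 2) K) :
    φ ∈ Subgroup.closure
      ({a : MvPolynomial (Fin 2) K ≃ₐ[K] MvPolynomial (Fin 2) K | IsAffineAut a} ∪
       {b : MvPolynomial (Fin 2) K ≃ₐ[K] MvPolynomial (Fin 2) K | IsTriangularAut b}) := by
  exact JVK.main _ φ le_rfl
end
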